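/- Let R be a commutative Noetherian local ring and let M and N be nonzero finitely generated R-modules. Set q := sup{i ≥ 0 : Tor_i^R(M, N) ≠ 0}. Suppose q < ∞ and qpd_R(M) < ∞. If q = 0, or if q > 0 and depth_R(Tor_q^R(M, N)) ≤ 1, then depth_R(N) = depth_R(Tor_q^R(M, N)) + qpd_R(M) − q. -/

import Mathlib

/-!
Quasi-projective dimension, following Gheibi–Jorgensen–Takahashi and
Chen–Chen–Liu, "Properties of quasi-projective dimension over abelian categories".
-/

open CategoryTheory CategoryTheory.Limits

attribute [local instance] CategoryTheory.Abelian.hasFiniteBiproducts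

noncomputable section

universe v u

namespace QPD

variable {A : Type*} [Category A] [Abelian A]

/-- The direct sum of `n` copies of `M`. -/
def copies (M : A) (n : ℕ) : A := ⨁ (fun _ : Fin n => M)

/-- `X` belongs to `add M`: it is a direct summand of a finite direct sum of copies of `M`. -/
def inAdd (M X : A) : Prop :=
  ∃ (n : ℕ) (s : X ⟶ copies M n) (r : copies M n ⟶ X), s ≫ r = 𝟙 X

/-- `P` is a quasi-projective resolution of `M`: a bounded-below complex of projective
objects whose `j`-th homology is a direct sum of `mult j` copies of `M`, where the
multiplicities `mult j` are not all zero. -/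
structure IsQuasiProjRes (M : A) (P : ChainComplex A ℤ) : Prop where
  projective : ∀ i, Projective (P.X i)
  bddBelow : ∃ a : ℤ, ∀ i, i < a → IsZero (P.X i)
  homology_iso : ∃ mult : ℤ → ℕ, (∃ j, mult j ≠ 0) ∧
    ∀ j, Nonempty (P.homology j ≅ copies M (mult j))

/-- `P` is a finite (i.e. bounded) quasi-projective resolution of `M`. -/
structure IsFiniteQuasiProjRes (M : A) (P : ChainComplex A ℤ) extends
    IsQuasiProjRes M P : Prop where
  bddAbove : ∃ b : ℤ, ∀ i, b < i → IsZero (P.X i)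

/-- `s` is the supremum of the degrees in which `P` is nonzero. -/
def IsSup (P : ChainComplex A ℤ) (s : ℤ) : Prop :=
  ¬ IsZero (P.X s) ∧ ∀ i, s < i → IsZero (P.X i)

/-- `t` is the supremum of the degrees in which the homology of `P` is nonzero. -/
def IsHSup (P : ChainComplex A ℤ) (t : ℤ) : Prop :=
  ¬ IsZero (P.homology t) ∧ ∀ i, t < i → IsZero (P.homology i)

/-- `t` is the infimum of the degrees in which the homology of `P` is nonzero. -/
def IsHInf (P : ChainComplex A ℤ) (t : ℤ) : Prop :=
  ¬ IsZero (P.homology t) ∧ ∀ i, i < t → IsZero (P.homology i)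

open Classical in
/-- The quasi-projective dimension of `M`, as an element of `ℕ∞`: the infimum of
`sup P• - hsup P•` over all finite quasi-projective resolutions `P•` of `M`
(it is `0` for the zero object and `⊤` if no finite quasi-projective resolution exists). -/
def qpd (M : A) : ℕ∞ :=
  if IsZero M then 0
  else sInf {d : ℕ∞ | ∃ (P : ChainComplex A ℤ) (s t : ℤ),
    IsFiniteQuasiProjRes M P ∧ IsSup P s ∧ IsHSup P t ∧ d = ((s - t).toNat : ℕ∞)}

/-- `M` admits a projective resolution of length at most `n`. -/
def pdLE (M : A) (n : ℕ) : Prop :=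
  ∃ P : ChainComplex A ℤ, (∀ i, Projective (P.X i)) ∧
    (∀ i : ℤ, i < 0 → IsZero (P.X i)) ∧ (∀ i : ℤ, (n : ℤ) < i → IsZero (P.X i)) ∧
    (∀ i : ℤ, i ≠ 0 → IsZero (P.homology i)) ∧ Nonempty (P.homology 0 ≅ M)

/-- The projective dimension of `M`, as an element of `ℕ∞`. -/
def pd (M : A) : ℕ∞ := sInf {d : ℕ∞ | ∃ n : ℕ, d = (n : ℕ∞) ∧ pdLE M n}

open Classical in
/-- Quasi-projective dimension computed using only complexes all of whose terms satisfy the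
predicate `Q` (e.g. `Q` = "finitely generated", for the category of finitely presented
modules over a left coherent ring). -/
def qpdRel (Q : A → Prop) (M : A) : ℕ∞ :=
  if IsZero M then 0
  else sInf {d : ℕ∞ | ∃ (P : ChainComplex A ℤ) (s t : ℤ),
    IsFiniteQuasiProjRes M P ∧ (∀ i, Q (P.X i)) ∧ IsSup P s ∧ IsHSup P t ∧
    d = ((s - t).toNat : ℕ∞)}

/-- Projective dimension computed using only resolutions all of whose terms satisfy the
predicate `Q`. -/
def pdRel (Q : A → Prop) (M : A) : ℕ∞ :=
  sInf {d : ℕ∞ | ∃ n : ℕ, d = (n : ℕ∞) ∧ ∃ P : ChainComplex A ℤ,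
    (∀ i, Projective (P.X i)) ∧ (∀ i, Q (P.X i)) ∧
    (∀ i : ℤ, i < 0 → IsZero (P.X i)) ∧ (∀ i : ℤ, (n : ℤ) < i → IsZero (P.X i)) ∧
    (∀ i : ℤ, i ≠ 0 → IsZero (P.homology i)) ∧ Nonempty (P.homology 0 ≅ M)}

/-- Vanishing of the `n`-th Ext group, `Ext_𝒜^n(M, N) = 0`. -/
def extIsZero [EnoughProjectives A] (M N : A) (n : ℕ) : Prop :=
  IsZero (((_root_.Ext ℤ A n).obj (Opposite.op M)).obj N)

/-- The quasi-projective dimension of a finitely presented module over a (left coherent)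
ring, computed inside the abelian category of finitely presented modules, i.e. via bounded
complexes of finitely generated projective modules. -/
def qpdFG {R : Type u} [Ring R] (M : ModuleCat.{u} R) : ℕ∞ :=
  qpdRel (fun N : ModuleCat.{u} R => Module.Finite R N) M

/-- The projective dimension of a finitely presented module over a (left coherent) ring,
computed inside the abelian category of finitely presented modules. -/
def pdFG {R : Type u} [Ring R] (M : ModuleCat.{u} R) : ℕ∞ :=
  pdRel (fun N : ModuleCat.{u} R => Module.Finite R N) M

/-- A ring is left coherent if every finitely generated left ideal is finitely presented. -/
def IsLeftCoherent (R : Type u) [Ring R] : Prop :=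
  ∀ I : Ideal R, I.FG → Module.FinitePresentation R I

/-- The quasi-global dimension of a ring: the supremum of the quasi-projective dimensions
of all finitely generated left modules. -/
def qgldim (R : Type u) [Ring R] : ℕ∞ :=
  sSup {d : ℕ∞ | ∃ M : ModuleCat.{u} R, Module.Finite R M ∧ d = qpd M}

/-- The global dimension of a ring: the supremum of the projective dimensions of all
finitely generated left modules. -/
def gldim (R : Type u) [Ring R] : ℕ∞ :=
  sSup {d : ℕ∞ | ∃ M : ModuleCat.{u} R, Module.Finite R M ∧ d = pd M}

/-- The finitistic dimension of a ring: the supremum of the projective dimensions of all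
finitely generated left modules of finite projective dimension. -/
def findim (R : Type u) [Ring R] : ℕ∞ :=
  sSup {d : ℕ∞ | ∃ M : ModuleCat.{u} R, Module.Finite R M ∧ d = pd M ∧ pd M ≠ ⊤}

/-- The depth of a module over a Noetherian local ring:
`depth M = inf {i : Ext^i(R/𝔪, M) ≠ 0}`. -/
def depth {R : Type u} [CommRing R] [IsLocalRing R] (M : ModuleCat.{u} R) : ℕ∞ :=
  sInf {d : ℕ∞ | ∃ n : ℕ, d = (n : ℕ∞) ∧
    ¬ IsZero (((_root_.Ext ℤ (ModuleCat.{u} R) n).obj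
      (Opposite.op (ModuleCat.of R (IsLocalRing.ResidueField R)))).obj M)}

end QPD

end

universe w

section ExtVanishing

open CategoryTheory.Abelian

variable {C : Type*} [Category.{v} C] [Abelian C] [HasExt.{w} C]

theorem CategoryTheory.ShortComplex.ShortExact.ext_eq_zero_of_comp_f {S : ShortComplex C}
    (hS : S.ShortExact) {X : C} {n : ℕ} (x : Abelian.Ext X S.X₁ n)
    (hx : x.comp (Ext.mk₀ S.f) (add_zero n) = 0)
    (h₃ : ∀ m, m + 1 = n → Subsingleton (Abelian.Ext X S.X₃ m)) : x = 0 := by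
  cases n with
  | zero =>
    have := hS.mono_f
    exact Ext.postcomp_mk₀_injective_of_mono X S.f (by simpa using hx)
  | succ m =>
    have := h₃ m rfl
    obtain ⟨y, rfl⟩ := Ext.covariant_sequence_exact₁ X hS x hx rfl
    rw [Subsingleton.elim y 0, Ext.zero_comp]

theorem CategoryTheory.ShortComplex.ShortExact.subsingleton_ext₁ {S : ShortComplex C}
    (hS : S.ShortExact) (X : C) (n : ℕ) (h₂ : Subsingleton (Abelian.Ext X S.X₂ n))
    (h₃ : ∀ m, m + 1 = n → Subsingleton (Abelian.Ext X S.X₃ m)) :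
    Subsingleton (Abelian.Ext X S.X₁ n) :=
  subsingleton_of_forall_eq 0 fun x =>
    hS.ext_eq_zero_of_comp_f x (Subsingleton.elim _ _) h₃

theorem CategoryTheory.ShortComplex.ShortExact.comp_extClass_comp_eq_zero {S₁ S₂ : ShortComplex C}
    (h₁ : S₁.ShortExact) (h₂ : S₂.ShortExact) (φ : S₁ ⟶ S₂) {X : C} {n : ℕ}
    (z : Abelian.Ext X S₁.X₃ n) (hz : z.comp (Ext.mk₀ φ.τ₃) (add_zero n) = 0) :
    (z.comp h₁.extClass rfl).comp (Ext.mk₀ φ.τ₁) (add_zero (n + 1)) = 0 := by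
  rw [Ext.comp_assoc z _ _ rfl (add_zero 1) rfl, extClass_naturality h₁ h₂ φ,
    ← Ext.comp_assoc z _ _ (add_zero n) (zero_add 1) (by lia), hz, Ext.zero_comp]

theorem CategoryTheory.ShortComplex.ShortExact.subsingleton_ext₂ {S : ShortComplex C}
    (hS : S.ShortExact) (X : C) (n : ℕ) (h₁ : Subsingleton (Abelian.Ext X S.X₁ n))
    (h₃ : Subsingleton (Abelian.Ext X S.X₃ n)) :
    Subsingleton (Abelian.Ext X S.X₂ n) := by
  refine subsingleton_of_forall_eq 0 fun x => ?_
  obtain ⟨y, rfl⟩ := Ext.covariant_sequence_exact₂ X hS x (Subsingleton.elim _ _)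
  rw [Subsingleton.elim y 0, Ext.zero_comp]

theorem CategoryTheory.ShortComplex.ShortExact.subsingleton_ext₃ {S : ShortComplex C}
    (hS : S.ShortExact) (X : C) (n : ℕ) (h₂ : Subsingleton (Abelian.Ext X S.X₂ n))
    (h₁ : Subsingleton (Abelian.Ext X S.X₁ (n + 1))) :
    Subsingleton (Abelian.Ext X S.X₃ n) := by
  refine subsingleton_of_forall_eq 0 fun x => ?_
  obtain ⟨y, rfl⟩ := Ext.covariant_sequence_exact₃ X hS x rfl (Subsingleton.elim _ _)
  rw [Subsingleton.elim y 0, Ext.zero_comp]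

theorem CategoryTheory.Iso.subsingleton_ext {Y Z : C} (e : Y ≅ Z) (X : C) (n : ℕ)
    [h : Subsingleton (Abelian.Ext X Y n)] : Subsingleton (Abelian.Ext X Z n) := by
  refine subsingleton_of_forall_eq 0 fun x => ?_
  have : (x.comp (Ext.mk₀ e.inv) (add_zero n)).comp (Ext.mk₀ e.hom) (add_zero n) = x := by
    simp
  rw [← this, Subsingleton.elim (x.comp (Ext.mk₀ e.inv) (add_zero n)) 0, Ext.zero_comp]

theorem CategoryTheory.Limits.IsZero.subsingleton_ext {Y : C} (h : IsZero Y) (X : C) (n : ℕ) :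
    Subsingleton (Abelian.Ext X Y n) := by
  refine subsingleton_of_forall_eq 0 fun x => ?_
  have : x.comp (Ext.mk₀ (𝟙 Y)) (add_zero n) = x := by simp
  rw [← this, h.eq_of_src (𝟙 Y) 0, Ext.mk₀_zero, Ext.comp_zero]

end ExtVanishing

namespace QPD

section Bridge

variable {C : Type*} [Category.{v} C] [Abelian C] [HasExt.{w} C] [EnoughProjectives C]

theorem isZero_ext_iff_subsingleton (X Y : C) (n : ℕ) :
    IsZero (((_root_.Ext ℤ C n).obj (Opposite.op X)).obj Y) ↔
      Subsingleton (Abelian.Ext X Y n) := by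
  let P := projectiveResolution X
  rw [(P.isoExt (R := ℤ) n Y).isZero_iff]
  cases n with
  | zero =>
    rw [← HomologicalComplex.exactAt_iff_isZero_homology,
      HomologicalComplex.exactAt_iff' _ 0 0 1 (by simp) (by simp),
      ShortComplex.moduleCat_exact_iff, Abelian.Ext.addEquiv₀.toEquiv.subsingleton_congr]
    constructor
    · intro h
      refine subsingleton_of_forall_eq 0 fun x => ?_
      change ((ChainComplex.single₀ C).obj X).X 0 ⟶ Y at x
      change x = 0
      rw [← cancel_epi (P.π.f 0)]
      have hc : P.complex.d 1 0 ≫ P.π.f 0 = 0 := P.complex_d_comp_π_f_zero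
      obtain ⟨g, hg⟩ := h (P.π.f 0 ≫ x) (by
        change P.complex.d 1 0 ≫ P.π.f 0 ≫ x = 0
        rw [reassoc_of% hc, zero_comp])
      change P.complex.X 0 ⟶ Y at g
      have hg' : P.complex.d 0 0 ≫ g = P.π.f 0 ≫ x := hg
      rw [P.complex.shape 0 0 (by simp), zero_comp] at hg'
      rw [← hg', comp_zero]
    · intro h f hf
      refine ⟨0, ?_⟩
      have hf' : P.complex.d 1 0 ≫ f = 0 := hf
      have : Epi (ShortComplex.mk _ _ P.complex_d_comp_π_f_zero).g :=
        inferInstanceAs (Epi (P.π.f 0))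
      have h₀ : P.exact₀.desc f hf' = 0 := Subsingleton.elim (α := X ⟶ Y) _ _
      rw [map_zero, ← P.exact₀.g_desc f hf', h₀, comp_zero]
      rfl
  | succ n =>
    rw [← HomologicalComplex.exactAt_iff_isZero_homology,
      HomologicalComplex.exactAt_iff' _ n (n + 1) (n + 2) (by simp) (by simp),
      ShortComplex.moduleCat_exact_iff]
    constructor
    · intro h
      refine subsingleton_of_forall_eq 0 fun x => ?_
      obtain ⟨f, hf, rfl⟩ := P.extMk_surjective x (n + 2) rfl
      rw [P.extMk_eq_zero_iff f _ rfl hf n rfl]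
      exact h f hf
    · intro h f hf
      exact (P.extMk_eq_zero_iff f (n + 2) rfl hf n rfl).1 (Subsingleton.elim _ _)

end Bridge

section Depth

variable {R : Type u} [CommRing R] [IsLocalRing R]

open IsLocalRing

theorem le_depth_iff (X : ModuleCat.{u} R) (n : ℕ) :
    (n : ℕ∞) ≤ depth X ↔ ∀ i < n,
      Subsingleton (Abelian.Ext (ModuleCat.of R (ResidueField R)) X i) := by
  simp only [depth, le_sInf_iff, Set.mem_ofPred_eq, ← isZero_ext_iff_subsingleton]
  constructor
  · intro h i hi
    by_contra hc
    exact absurd (h i ⟨i, rfl, hc⟩) (by simpa using hi)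
  · rintro h _ ⟨m, rfl, hm⟩
    by_contra hc
    exact hm (h m (by simpa using hc))

end Depth

section Spliced

open CategoryTheory.Abelian

variable {C : Type*} [Category.{v} C] [Abelian C] [HasExt.{w} C] (X : C)
  {A Y : ℕ → C} {u : ∀ n, A n ⟶ Y n} {p : ∀ n, Y n ⟶ A (n + 1)} {w : ∀ n, u n ≫ p n = 0}
  {L D : ℕ}

theorem subsingleton_ext_of_spliced (hS : ∀ n < L, (ShortComplex.mk _ _ (w n)).ShortExact)
    (hY : ∀ n, ∀ i < D, Subsingleton (Abelian.Ext X (Y n) i))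
    (hA : ∀ i < D, Subsingleton (Abelian.Ext X (A 0) i)) :
    ∀ n ≤ L, ∀ i, i + n < D → Subsingleton (Abelian.Ext X (A n) i) := by
  intro n
  induction n with
  | zero => exact fun _ => hA
  | succ n ih =>
    intro hn i hi
    exact (hS n hn).subsingleton_ext₃ X i (hY n i (by lia)) (ih (by lia) (i + 1) (by lia))

theorem exists_ext_ne_zero_of_spliced (hS : ∀ n < L, (ShortComplex.mk _ _ (w n)).ShortExact)
    (hY : ∀ n, ∀ i < D, Subsingleton (Abelian.Ext X (Y n) i))
    (x : Abelian.Ext X (A 0) D) (hx : x ≠ 0) (hxu : x.comp (Ext.mk₀ (u 0)) (add_zero D) = 0) :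
    ∀ n ≤ L, ∃ c, c + n = D ∧ ∃ y : Abelian.Ext X (A n) c,
      y ≠ 0 ∧ y.comp (Ext.mk₀ (u n)) (add_zero c) = 0 := by
  intro n
  induction n with
  | zero => exact fun _ => ⟨D, rfl, x, hx, hxu⟩
  | succ n ih =>
    intro hn
    obtain ⟨c, hc, y, hy, hyu⟩ := ih (by lia)
    cases c with
    | zero =>
      exact absurd ((hS n hn).ext_eq_zero_of_comp_f y hyu (by lia)) hy
    | succ c =>
      obtain ⟨z, rfl⟩ := Ext.covariant_sequence_exact₁ X (hS n hn) y hyu rfl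
      refine ⟨c, by lia, z, ?_, ?_⟩
      · rintro rfl
        exact hy (Ext.zero_comp ..)
      · have := hY (n + 1) c (by lia)
        exact Subsingleton.elim _ _

theorem subsingleton_ext_of_shortExact_of_shortExact {S₁ S₂ : ShortComplex C}
    (h₁ : S₁.ShortExact) (h₂ : S₂.ShortExact) (e : S₁.X₃ = S₂.X₁) {d : ℕ}
    (hA : Subsingleton (Abelian.Ext X S₁.X₂ d))
    (hY : ∀ i, i + 1 = d → Subsingleton (Abelian.Ext X S₂.X₂ i))
    (hC : ∀ i, i + 2 = d → Subsingleton (Abelian.Ext X S₂.X₃ i)) :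
    Subsingleton (Abelian.Ext X S₁.X₁ d) := by
  refine h₁.subsingleton_ext₁ X d hA fun m hm => ?_
  rw [e]
  exact h₂.subsingleton_ext₁ X m (hY m hm) fun n hn => hC n (by lia)

theorem ext_eq_zero_of_shortExact_of_shortExact {T A I Y C' : C} {i : T ⟶ A} {f : A ⟶ I}
    {g : I ⟶ Y} {h : Y ⟶ C'} {w₁ : i ≫ f = 0} {w₂ : g ≫ h = 0}
    (h₁ : (ShortComplex.mk i f w₁).ShortExact) (h₂ : (ShortComplex.mk g h w₂).ShortExact) {c : ℕ}
    (x : Abelian.Ext X A c) (hx : x.comp (Ext.mk₀ (f ≫ g)) (add_zero c) = 0)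
    (hC : ∀ i, i + 1 = c → Subsingleton (Abelian.Ext X C' i))
    (hT : Subsingleton (Abelian.Ext X T c)) : x = 0 := by
  have hxf : x.comp (Ext.mk₀ f) (add_zero c) = 0 := by
    have hxfg : (x.comp (Ext.mk₀ f) (add_zero c)).comp (Ext.mk₀ g) (add_zero c) = 0 := by
      simpa using hx
    exact h₂.ext_eq_zero_of_comp_f _ hxfg hC
  obtain ⟨z, hz⟩ := Ext.covariant_sequence_exact₂ X h₁ x hxf
  rw [← hz, Subsingleton.elim z 0, Ext.zero_comp]

end Spliced

section Depth

variable {R : Type u} [CommRing R] [IsLocalRing R]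

open IsLocalRing

theorem depth_eq_depth_add_of_spliced {N : ModuleCat.{u} R}
    {A Y : ℕ → ModuleCat.{u} R} {u : ∀ n, A n ⟶ Y n} {p : ∀ n, Y n ⟶ A (n + 1)}
    {w : ∀ n, u n ≫ p n = 0} {L : ℕ}
    (hS : ∀ n < L, (ShortComplex.mk _ _ (w n)).ShortExact)
    {T I C : ModuleCat.{u} R} {i : T ⟶ A L} {f : A L ⟶ I}
    {g : I ⟶ Y L} {h : Y L ⟶ C} {w₁ : i ≫ f = 0} {w₂ : g ≫ h = 0} (hu : f ≫ g = u L)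
    (h₁ : (ShortComplex.mk i f w₁).ShortExact) (h₂ : (ShortComplex.mk g h w₂).ShortExact)
    (hA : ∀ n : ℕ, n ≤ depth N → n ≤ depth (A 0))
    (hY : ∀ n : ℕ, n ≤ depth N → ∀ m, n ≤ depth (Y m))
    (hx : ∀ D : ℕ, depth N = D →
      ∃ x : Abelian.Ext (ModuleCat.of R (ResidueField R)) (A 0) D, x ≠ 0 ∧
        x.comp (Abelian.Ext.mk₀ (u 0)) (add_zero D) = 0)
    (hC : ∀ n : ℕ, n ≤ depth N → (n + 1 : ℕ) ≤ depth T → n ≤ depth C) :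
    depth N = depth T + L := by
  apply le_antisymm
  · by_contra! hlt
    obtain ⟨d, hd⟩ := ENat.ne_top_iff_exists.1 (show depth T ≠ ⊤ by
      intro hT
      simp [hT] at hlt)
    have hD : ((d + L + 1 : ℕ) : ℕ∞) ≤ depth N := by
      rw [← hd] at hlt
      push_cast
      exact Order.add_one_le_of_lt hlt
    suffices ((d + 1 : ℕ) : ℕ∞) ≤ depth T by
      rw [← hd] at this
      norm_cast at this
      lia
    have hdT := (le_depth_iff T d).1 hd.le
    rw [le_depth_iff]
    intro j hj
    obtain hj | rfl : j < d ∨ j = d := by lia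
    · exact hdT j hj
    refine subsingleton_ext_of_shortExact_of_shortExact _ h₁ h₂ rfl ?_ ?_ ?_
    · exact subsingleton_ext_of_spliced _ hS
        (fun n => (le_depth_iff _ _).1 (hY _ hD n)) ((le_depth_iff _ _).1 (hA _ hD)) L le_rfl j
        (by lia)
    · intro i hi
      exact (le_depth_iff _ _).1 (hY _ hD L) i (by lia)
    · rintro i rfl
      refine (le_depth_iff _ _).1 (hC (i + 1) (le_trans ?_ hD) hd.le) i (by lia)
      exact_mod_cast (by lia)
  · by_cases hN : depth N = ⊤
    · simp [hN]
    obtain ⟨D, hD⟩ := ENat.ne_top_iff_exists.1 hN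
    obtain ⟨x, hx0, hxu⟩ := hx D hD.symm
    obtain ⟨c, hc, y, hy, hyu⟩ := exists_ext_ne_zero_of_spliced _ hS
      (fun n => (le_depth_iff _ _).1 (hY _ hD.le n)) x hx0 hxu L le_rfl
    suffices depth T ≤ c by
      rw [← hD, ← hc]
      push_cast
      gcongr
    by_contra! hlt
    have hcT : ((c + 1 : ℕ) : ℕ∞) ≤ depth T := by
      push_cast
      exact Order.add_one_le_of_lt hlt
    refine hy (ext_eq_zero_of_shortExact_of_shortExact _ h₁ h₂ y (by rw [hu, hyu]) ?_
      ((le_depth_iff _ _).1 hcT c (by lia)))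
    rintro i rfl
    refine (le_depth_iff _ _).1 (hC (i + 1) (hD ▸ ?_) (le_trans ?_ hcT)) i (by lia)
    all_goals exact_mod_cast (by lia)

end Depth

section TensorProjective

open CategoryTheory.Abelian MonoidalCategory

variable {R : Type u} [CommRing R]

theorem comp_mk₀_smul_eq_zero {K : ModuleCat.{u} R} {x : R} (hx : x ∈ Module.annihilator R K)
    {N : ModuleCat.{u} R} {n : ℕ} (y : Abelian.Ext K N n) :
    y.comp (Ext.mk₀ (x • 𝟙 N)) (add_zero n) = 0 := by
  have := Ext.postcomp_smul_id_eq_zero_of_mem_annihilator (M := N) hx n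
  exact DFunLike.congr_fun (congrArg AddCommGrpCat.Hom.hom this) y

theorem tensorLeft_map_smulShortComplex_f (P N : ModuleCat.{u} R) (x : R) :
    ((N.smulShortComplex x).map (tensorLeft P)).f = x • 𝟙 (P ⊗ N) := by
  change P ◁ (x • 𝟙 N) = _
  ext : 1
  exact TensorProduct.ext' fun _ _ => TensorProduct.tmul_smul _ _ _

section IsLocalRing

variable [IsLocalRing R]

open IsLocalRing

theorem exists_hom_residueField_of_ne_zero (X : ModuleCat.{u} R)
    (hX : maximalIdeal R ≤ Module.annihilator R X) (v : X) (hv : v ≠ 0) :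
    ∃ f : ModuleCat.of R (ResidueField R) ⟶ X, f ≠ 0 ∧ ∀ a, ∃ r : R, f a = r • v := by
  let f : ResidueField R →ₗ[R] X := Submodule.liftQ (maximalIdeal R)
    (LinearMap.toSpanSingleton R X v) fun r hr => by
      rw [LinearMap.mem_ker, LinearMap.toSpanSingleton_apply]
      exact Module.mem_annihilator.1 (hX hr) v
  refine ⟨ModuleCat.ofHom f, fun h => hv ?_, fun a => ?_⟩
  · have h1 : f (residue R 1) = (1 : R) • v := rfl
    rw [← one_smul R v, ← h1]
    exact congrArg (fun g => g.hom (residue R 1)) h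
  · obtain ⟨r, rfl⟩ := residue_surjective a
    exact ⟨r, rfl⟩

theorem mono_of_ne_zero_residueField {N : ModuleCat.{u} R}
    (f : ModuleCat.of R (ResidueField R) ⟶ N) (hf : f ≠ 0) : Mono f := by
  rw [ModuleCat.mono_iff_injective]
  change Function.Injective f.hom
  rw [← LinearMap.ker_eq_bot, LinearMap.ker_eq_bot']
  intro a ha
  by_contra hne
  refine hf ?_
  ext b
  obtain ⟨r, hr⟩ := residue_surjective (b * a⁻¹)
  have : b = r • a := by
    rw [Algebra.smul_def]
    change b = residue R r * a
    rw [hr, mul_assoc, inv_mul_cancel₀ hne, mul_one]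
  rw [this, map_smul, ha, smul_zero]
  rfl

theorem maximalIdeal_le_annihilator_tensor_residueField (P : ModuleCat.{u} R) :
    maximalIdeal R ≤
      Module.annihilator R (P ⊗ ModuleCat.of R (ResidueField R) : ModuleCat.{u} R) := by
  intro r hr
  rw [Module.mem_annihilator]
  intro y
  have hk : r • 𝟙 (ModuleCat.of R (ResidueField R)) = 0 := by
    ext a
    change r • a = 0
    rw [Algebra.smul_def]
    change residue R r * a = 0
    rw [(residue_eq_zero_iff r).2 hr, zero_mul]
  have : r • 𝟙 (P ⊗ ModuleCat.of R (ResidueField R)) = 0 := by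
    rw [← MonoidalCategory.whiskerLeft_id, ← MonoidalLinear.whiskerLeft_smul, hk]
    simp
  exact congr($this y)

end IsLocalRing

variable [IsNoetherianRing R]

theorem exists_isSMulRegular_of_subsingleton_ext (K N : ModuleCat.{u} R) [Module.Finite R K]
    [Module.Finite R N] (h : Subsingleton (Abelian.Ext K N 0)) :
    ∃ x ∈ Module.annihilator R K, IsSMulRegular N x := by
  have : Subsingleton (K ⟶ N) := Ext.addEquiv₀.subsingleton_congr.mp h
  have : Subsingleton (K →ₗ[R] N) := ModuleCat.homAddEquiv.symm.subsingleton
  exact IsSMulRegular.subsingleton_linearMap_iff.mp this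

theorem subsingleton_ext_tensor (K P N : ModuleCat.{u} R) [Module.Finite R K]
    [Module.Finite R N] [Module.Flat R P] (D : ℕ)
    (hN : ∀ i < D, Subsingleton (Abelian.Ext K N i)) :
    ∀ i < D, Subsingleton (Abelian.Ext K (P ⊗ N) i) := by
  induction D generalizing N with
  | zero => simp
  | succ D ih =>
    obtain ⟨x, hxK, hxN⟩ := exists_isSMulRegular_of_subsingleton_ext K N (hN 0 (by lia))
    have hS := hxN.smulShortComplex_shortExact
    have hPS := hS.map_of_exact (tensorLeft P)
    have hx := ih (ModuleCat.of R (QuotSMulTop x N)) fun i hi =>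
      hS.subsingleton_ext₃ K i (hN i (by lia)) (hN (i + 1) (by lia))
    refine fun i hi => subsingleton_of_forall_eq 0 fun y => ?_
    have hy : y.comp (Ext.mk₀ ((N.smulShortComplex x).map (tensorLeft P)).f) (add_zero i) = 0 := by
      rw [tensorLeft_map_smulShortComplex_f]
      exact comp_mk₀_smul_eq_zero hxK y
    exact hPS.ext_eq_zero_of_comp_f y hy fun m hm => hx m (by lia)

variable [IsLocalRing R]

open IsLocalRing

theorem exists_ext_comp_whiskerRight_eq_zero (N P P' : ModuleCat.{u} R)
    [Module.Finite R N] [Module.Flat R P] [Module.Flat R P'] (f : P ⟶ P')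
    (hf : ¬ Mono (f ▷ ModuleCat.of R (ResidueField R))) (D : ℕ)
    (hN : ∀ i < D, Subsingleton (Abelian.Ext (ModuleCat.of R (ResidueField R)) N i))
    (hD : ¬ Subsingleton (Abelian.Ext (ModuleCat.of R (ResidueField R)) N D)) :
    ∃ x : Abelian.Ext (ModuleCat.of R (ResidueField R)) (P ⊗ N) D,
      x ≠ 0 ∧ x.comp (Ext.mk₀ (f ▷ N)) (add_zero D) = 0 := by
  induction D generalizing N with
  | zero =>
    set K := ModuleCat.of R (ResidueField R)
    rw [Ext.addEquiv₀.toEquiv.subsingleton_congr, not_subsingleton_iff_nontrivial] at hD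
    obtain ⟨g, hg⟩ := exists_ne (0 : K ⟶ N)
    have := mono_of_ne_zero_residueField g hg
    obtain ⟨v, hv, hfv⟩ : ∃ v : (P ⊗ K : ModuleCat.{u} R), v ≠ 0 ∧ (f ▷ K) v = 0 := by
      by_contra! h
      refine hf ((ModuleCat.mono_iff_injective _).2 ?_)
      refine (injective_iff_map_eq_zero (f ▷ K).hom).2 fun v hv => ?_
      by_contra hne
      exact h v hne hv
    obtain ⟨φ, hφ, hφv⟩ := exists_hom_residueField_of_ne_zero _
      (maximalIdeal_le_annihilator_tensor_residueField P) v hv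
    have hφf : φ ≫ f ▷ K = 0 := by
      ext a
      obtain ⟨r, hr⟩ := hφv a
      change (f ▷ K) (φ a) = 0
      rw [hr, map_smul, hfv, smul_zero]
    have : Mono (P ◁ g) := inferInstanceAs (Mono ((tensorLeft P).map g))
    refine ⟨Ext.mk₀ (φ ≫ P ◁ g), fun h => hφ ?_, ?_⟩
    · rw [Ext.mk₀_eq_zero_iff] at h
      rwa [← cancel_mono (P ◁ g), zero_comp]
    · rw [Ext.mk₀_comp_mk₀, Category.assoc, whisker_exchange, reassoc_of% hφf, zero_comp,
        Ext.mk₀_zero]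
  | succ D ih =>
    set K := ModuleCat.of R (ResidueField R)
    obtain ⟨x, hxK, hxN⟩ := exists_isSMulRegular_of_subsingleton_ext K N (hN 0 (by lia))
    have hS := hxN.smulShortComplex_shortExact
    have hPS := hS.map_of_exact (tensorLeft P)
    have hPS' := hS.map_of_exact (tensorLeft P')
    let φ : (N.smulShortComplex x).map (tensorLeft P) ⟶ (N.smulShortComplex x).map (tensorLeft P') :=
      (N.smulShortComplex x).mapNatTrans ((tensoringLeft _).map f)
    obtain ⟨z, hz, hzf⟩ := ih (ModuleCat.of R (QuotSMulTop x N))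
      (fun i hi => hS.subsingleton_ext₃ K i (hN i (by lia)) (hN (i + 1) (by lia))) (fun h => by
        refine hD (subsingleton_of_forall_eq 0 fun y => ?_)
        have hy : y.comp (Ext.mk₀ (N.smulShortComplex x).f) (add_zero _) = 0 :=
          comp_mk₀_smul_eq_zero hxK y
        exact hS.ext_eq_zero_of_comp_f y hy fun m hm => by
          obtain rfl : m = D := by lia
          exact h)
    refine ⟨z.comp hPS.extClass rfl, fun h => hz ?_, ?_⟩
    · obtain ⟨y, rfl⟩ := Ext.covariant_sequence_exact₃ K hPS z rfl h
      have hy : y = 0 := (subsingleton_ext_tensor K P N (D + 1) hN D (by lia)).elim _ _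
      rw [hy]
      exact Ext.zero_comp ..
    · exact hPS.comp_extClass_comp_eq_zero hPS' φ z hzf

end TensorProjective

section SplitInjections

open IsLocalRing LinearMap

variable {R : Type u} [CommRing R]
variable {F G : Type u} [AddCommGroup F] [Module R F] [AddCommGroup G] [Module R G]

theorem exists_leftInverse_of_coprod_surjective [IsNoetherianRing R] [IsLocalRing R]
    {E : Type u} [AddCommGroup E] [Module R E] [Module.Projective R G]
    [Module.Finite R E] [Module.Free R E] (h : F →ₗ[R] G) (e : E →ₗ[R] G)
    (hs : Function.Surjective (h.coprod e)) (hk : (ker h).FG)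
    (hinj : Function.Injective (h.lTensor (ResidueField R))) :
    ∃ r : G →ₗ[R] F, r ∘ₗ h = LinearMap.id := by
  set g := h.coprod e with hg
  obtain ⟨s, hs⟩ := Module.projective_lifting_property g LinearMap.id hs
  have hs (x) : g (s x) = x := LinearMap.congr_fun hs x
  have hK : (ker g).FG := by
    refine Submodule.fg_of_fg_map_of_fg_inf_ker (LinearMap.snd R F E)
      (IsNoetherian.noetherian _) ?_
    suffices h₁ : ker g ⊓ ker (LinearMap.snd R F E) = (ker h).map (LinearMap.inl R F E) from
      h₁ ▸ hk.map _
    refine Submodule.ext fun ⟨x, y⟩ => ?_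
    simp only [hg, Submodule.mem_inf, mem_ker, coprod_apply, snd_apply, Submodule.mem_map,
      inl_apply, Prod.mk.injEq]
    constructor
    · rintro ⟨h₁, rfl⟩
      exact ⟨x, by simpa using h₁, rfl, rfl⟩
    · rintro ⟨x, h₁, rfl, rfl⟩
      exact ⟨by simpa using h₁, rfl⟩
  have : Module.Finite R (ker g) := .of_fg hK
  set j : ker g →ₗ[R] E := LinearMap.snd R F E ∘ₗ (ker g).subtype
  have hj : Function.Injective (j.lTensor (ResidueField R)) := by
    rw [injective_iff_map_eq_zero]
    intro x hx
    set y := (ker g).subtype.lTensor (ResidueField R) x with hy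
    have hy₁ : (LinearMap.snd R F E).lTensor (ResidueField R) y = 0 := by
      rw [hy, ← LinearMap.comp_apply, ← lTensor_comp]
      exact hx
    have hy₂ : (LinearMap.fst R F E).lTensor (ResidueField R) y = 0 := by
      refine (injective_iff_map_eq_zero _).1 hinj _ ?_
      have h₁ : h ∘ₗ LinearMap.fst R F E = g - e ∘ₗ LinearMap.snd R F E := by
        ext <;> simp [hg]
      have h₂ : g ∘ₗ (ker g).subtype = 0 := by ext x; exact x.2
      rw [← LinearMap.comp_apply, ← lTensor_comp, h₁, lTensor_sub, lTensor_comp,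
        LinearMap.sub_apply, LinearMap.comp_apply, hy₁, map_zero, sub_zero, hy,
        ← LinearMap.comp_apply, ← lTensor_comp, h₂, lTensor_zero, LinearMap.zero_apply]
    have hy₃ : y = 0 := by
      have h₁ : LinearMap.inl R F E ∘ₗ LinearMap.fst R F E +
          LinearMap.inr R F E ∘ₗ LinearMap.snd R F E = LinearMap.id := by
        ext <;> simp
      have h₂ := LinearMap.congr_fun (congrArg (lTensor (ResidueField R)) h₁) y
      rw [lTensor_add, lTensor_comp, lTensor_comp, LinearMap.add_apply, LinearMap.comp_apply,
        LinearMap.comp_apply, hy₁, hy₂, map_zero, map_zero, add_zero, lTensor_id] at h₂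
      exact h₂.symm
    let ρ : F × E →ₗ[R] ker g := (LinearMap.id - s ∘ₗ g).codRestrict _ fun p => by
      simp [hs]
    have hρ : ρ ∘ₗ (ker g).subtype = LinearMap.id := by
      ext1 x
      refine Subtype.ext ?_
      have : g x = 0 := x.2
      simp [ρ, this]
    have h₁ := LinearMap.congr_fun (congrArg (lTensor (ResidueField R)) hρ) x
    rw [lTensor_comp, LinearMap.comp_apply, ← hy, hy₃, map_zero, lTensor_id] at h₁
    exact h₁.symm
  obtain ⟨ρ, hρ⟩ := (split_injective_iff_lTensor_residueField_injective j).2 hj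
  let Ψ : F × E →ₗ[R] F := LinearMap.fst R F E -
    (LinearMap.fst R F E ∘ₗ (ker g).subtype ∘ₗ ρ) ∘ₗ LinearMap.snd R F E
  have hΨ (p : F × E) (hp : g p = 0) : Ψ p = 0 := by
    have := LinearMap.congr_fun hρ ⟨p, hp⟩
    have h₁ : ρ p.2 = ⟨p, hp⟩ := this
    simp [Ψ, h₁]
  refine ⟨Ψ ∘ₗ s, ?_⟩
  ext x
  have hgx : g (x, 0) = h x := by simp [hg]
  have h₁ := hΨ (s (h x) - (x, 0)) (by rw [map_sub, hs, hgx, sub_self])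
  rw [map_sub, sub_eq_zero] at h₁
  simpa [Ψ] using h₁

/-- A linear map which factors, with a partial inverse, through a map whose cokernel is
finitely generated and whose target is projective. -/
def IsFiniteSplit (d : F →ₗ[R] G) : Prop :=
  ∃ (V : Type u) (_ : AddCommGroup V) (_ : Module R V) (_ : Module.Projective R V)
    (h : F →ₗ[R] V) (π : V →ₗ[R] G) (ι : G →ₗ[R] V)
    (E : Type u) (_ : AddCommGroup E) (_ : Module R E)
    (_ : Module.Finite R E) (_ : Module.Free R E) (e : E →ₗ[R] V),
    π ∘ₗ h = d ∧ ι ∘ₗ d = h ∧ Function.Surjective (h.coprod e)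

theorem IsFiniteSplit.of_subsingleton [Subsingleton F] (d : F →ₗ[R] G) : IsFiniteSplit d :=
  ⟨PUnit, inferInstance, inferInstance, inferInstance, 0, 0, 0, PUnit,
    inferInstance, inferInstance, inferInstance, inferInstance, 0,
    Subsingleton.elim _ _, Subsingleton.elim _ _, fun _ => ⟨0, Subsingleton.elim _ _⟩⟩

theorem IsFiniteSplit.exists_leftInverse [IsNoetherianRing R] [IsLocalRing R]
    {d : F →ₗ[R] G} (hd : IsFiniteSplit d)
    (hk : (ker d).FG) (hinj : Function.Injective (d.lTensor (ResidueField R))) :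
    ∃ r : G →ₗ[R] F, r ∘ₗ d = LinearMap.id := by
  obtain ⟨V, _, _, _, h, π, ι, E, _, _, _, _, e, h₁, h₂, hs⟩ := hd
  have hker : ker h = ker d :=
    le_antisymm (h₁ ▸ ker_le_ker_comp h π) (h₂ ▸ ker_le_ker_comp d ι)
  obtain ⟨r, hr⟩ := exists_leftInverse_of_coprod_surjective h e hs (hker ▸ hk) (by
    rw [← h₁, lTensor_comp] at hinj
    exact Function.Injective.of_comp hinj)
  exact ⟨r ∘ₗ ι, by rw [comp_assoc, h₂, hr]⟩

theorem IsFiniteSplit.of_comp_eq_zero [IsNoetherianRing R] {F' : Type u} [AddCommGroup F'] [Module R F']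
    [Module.Projective R F] {d : F →ₗ[R] G} (hd : IsFiniteSplit d) (d' : F' →ₗ[R] F)
    (w : d ∘ₗ d' = 0) (N : Submodule R F) (hN : N.FG) (hNd : N ≤ ker d)
    (hker : ker d ≤ range d' ⊔ N) : IsFiniteSplit d' := by
  obtain ⟨V, _, _, _, h, π, ι, E, _, _, _, _, e, h₁, h₂, hs⟩ := hd
  set g := h.coprod e with hg
  obtain ⟨s, hs⟩ := Module.projective_lifting_property g LinearMap.id hs
  have hs (x) : g (s x) = x := LinearMap.congr_fun hs x
  have hd₀ (x : F) (hx : d x = 0) : h x = 0 := by rw [← h₂, LinearMap.comp_apply, hx, map_zero]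
  have : Module.Projective R (ker g) := by
    refine Module.Projective.of_split (ker g).subtype
      ((LinearMap.id - s ∘ₗ g).codRestrict _ fun p => by simp [hs]) ?_
    ext1 x
    refine Subtype.ext ?_
    have : g x = 0 := x.2
    simp [this]
  obtain ⟨l, b, hb⟩ := Module.Finite.exists_fin' R
    (range (LinearMap.snd R F E ∘ₗ (ker g).subtype))
  obtain ⟨c, hc⟩ := Module.projective_lifting_property
    (LinearMap.snd R F E ∘ₗ (ker g).subtype).rangeRestrict b
    (surjective_rangeRestrict _)
  have : Module.Finite R N := .of_fg hN
  obtain ⟨m, a, ha⟩ := Module.Finite.exists_fin' R N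
  let ι₀ : ker d →ₗ[R] ker g := (LinearMap.inl R F E ∘ₗ (ker d).subtype).codRestrict _
    fun x => by simp [hg, hd₀ x.1 x.2]
  let a' : (Fin m → R) →ₗ[R] ker g := ι₀ ∘ₗ Submodule.inclusion hNd ∘ₗ a
  have hgx (x : F) : g (x, 0) = h x := by simp [hg]
  refine ⟨ker g, inferInstance, inferInstance, inferInstance,
    ι₀ ∘ₗ d'.codRestrict _ (fun x => LinearMap.congr_fun w x),
    LinearMap.fst R F _ ∘ₗ (ker g).subtype,
    (LinearMap.inl R F E - s ∘ₗ h).codRestrict _ fun x => ?_,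
    (Fin l → R) × (Fin m → R), inferInstance, inferInstance, inferInstance, inferInstance,
    c.coprod a', ?_, ?_, ?_⟩
  · simp [hs, hgx]
  · exact LinearMap.ext fun x => rfl
  · refine LinearMap.ext fun x => Subtype.ext ?_
    change (d' x, (0 : E)) - s (h (d' x)) = (d' x, 0)
    rw [hd₀ (d' x) (LinearMap.congr_fun w x), map_zero, sub_zero]
  · intro y
    obtain ⟨t, ht⟩ := hb ⟨y.1.2, y, rfl⟩
    have h₃ : (c t).1.2 = y.1.2 := by
      rw [← hc] at ht
      exact congrArg Subtype.val ht
    have h₄ : h (y - c t).1.1 = 0 := by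
      rw [← hgx, ← (y - c t).2]
      exact congrArg g (Prod.ext rfl (by simp [h₃]))
    have h₅ : (y - c t).1.1 ∈ ker d := by rw [mem_ker, ← h₁, LinearMap.comp_apply, h₄, map_zero]
    obtain ⟨_, ⟨p, rfl⟩, z, hz, hp⟩ := Submodule.mem_sup.1 (hker h₅)
    obtain ⟨r, hr⟩ := ha ⟨z, hz⟩
    refine ⟨(p, t, r), Subtype.ext (Prod.ext ?_ ?_)⟩
    · change d' p + ((c t).1.1 + (a r).1) = y.1.1
      rw [hr, add_left_comm, hp]
      exact add_sub_cancel (c t).1.1 y.1.1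
    · change 0 + ((c t).1.2 + 0) = y.1.2
      rw [h₃, add_zero, zero_add]

end SplitInjections

section Complexes

open IsLocalRing MonoidalCategory

variable {R : Type u} [CommRing R]

theorem exists_fg_ker_le_range_sup (S : ShortComplex (ModuleCat.{u} R))
    [Module.Finite R S.homology] :
    ∃ N : Submodule R S.X₂, N.FG ∧ N ≤ LinearMap.ker S.g.hom ∧
      LinearMap.ker S.g.hom ≤ LinearMap.range S.f.hom ⊔ N := by
  have : Module.Finite R (LinearMap.ker S.g.hom ⧸ LinearMap.range S.moduleCatToCycles) :=
    Module.Finite.equiv S.moduleCatHomologyIso.toLinearEquiv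
  obtain ⟨n, f, hf⟩ := Module.Finite.exists_fin' R
    (LinearMap.ker S.g.hom ⧸ LinearMap.range S.moduleCatToCycles)
  obtain ⟨l, hl⟩ := Module.projective_lifting_property
    (LinearMap.range S.moduleCatToCycles).mkQ f (Submodule.mkQ_surjective _)
  refine ⟨LinearMap.range ((LinearMap.ker S.g.hom).subtype ∘ₗ l), ?_, ?_, ?_⟩
  · rw [LinearMap.range_eq_map]
    exact (Module.Finite.fg_top).map _
  · rintro _ ⟨x, rfl⟩
    exact (l x).2
  · intro x hx
    obtain ⟨y, hy⟩ := hf (Submodule.Quotient.mk ⟨x, hx⟩)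
    rw [← hl] at hy
    obtain ⟨z, hz⟩ := (Submodule.Quotient.eq _).1 hy
    refine Submodule.mem_sup.2 ⟨-S.f z, ⟨-z, map_neg _ _⟩, (l y).1, ⟨y, rfl⟩, ?_⟩
    have h₁ : S.f z = (l y).1 - x := congrArg Subtype.val hz
    rw [h₁]
    abel

theorem isFiniteSplit_d [IsNoetherianRing R] (P : ChainComplex (ModuleCat.{u} R) ℤ)
    (hP : ∀ i, Projective (P.X i)) (hH : ∀ i, Module.Finite R (P.homology i))
    {a : ℤ} (ha : ∀ i, i < a → IsZero (P.X i)) (i : ℤ) :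
    IsFiniteSplit (P.d (i + 1) i).hom := by
  rcases lt_or_ge i (a - 2) with hi | hi
  · have := ModuleCat.subsingleton_of_isZero (ha (i + 1) (by lia))
    exact .of_subsingleton _
  · induction i, hi using Int.leInduction with
    | base =>
      have := ModuleCat.subsingleton_of_isZero (ha (a - 2 + 1) (by lia))
      exact .of_subsingleton _
    | succ i hi ih =>
      have : Module.Projective R (P.X (i + 1)) := (IsProjective.iff_projective _).2 (hP _)
      have : Module.Finite R (P.sc (i + 1)).homology := hH (i + 1)
      have : Module.Finite R (P.sc' (i + 1 + 1) (i + 1) i).homology :=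
        Module.Finite.equiv (ShortComplex.homologyMapIso
          (P.isoSc' (i + 1 + 1) (i + 1) i (by simp) (by simp))).toLinearEquiv
      obtain ⟨N, hN, hNd, hker⟩ := exists_fg_ker_le_range_sup (P.sc' (i + 1 + 1) (i + 1) i)
      refine ih.of_comp_eq_zero _ ?_ N hN hNd hker
      rw [← ModuleCat.hom_comp, P.d_comp_d, ModuleCat.hom_zero]

theorem isSplitMono_d_of_mono_whiskerRight [IsNoetherianRing R] [IsLocalRing R]
    (P : ChainComplex (ModuleCat.{u} R) ℤ)
    (hP : ∀ i, Projective (P.X i)) (hH : ∀ i, Module.Finite R (P.homology i))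
    {a : ℤ} (ha : ∀ i, i < a → IsZero (P.X i)) {i : ℤ} (hi : IsZero (P.X (i + 1 + 1)))
    (hm : Mono (P.d (i + 1) i ▷ ModuleCat.of R (ResidueField R))) :
    IsSplitMono (P.d (i + 1) i) := by
  have : Module.Finite R (P.sc (i + 1)).homology := hH (i + 1)
  have : Module.Finite R (P.sc' (i + 1 + 1) (i + 1) i).homology :=
    Module.Finite.equiv (ShortComplex.homologyMapIso
      (P.isoSc' (i + 1 + 1) (i + 1) i (by simp) (by simp))).toLinearEquiv
  obtain ⟨N, hN, hNd, hker⟩ := exists_fg_ker_le_range_sup (P.sc' (i + 1 + 1) (i + 1) i)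
  have hr : LinearMap.range (P.d (i + 1 + 1) (i + 1)).hom = ⊥ := by
    rw [hi.eq_of_src (P.d (i + 1 + 1) (i + 1)) 0, ModuleCat.hom_zero, LinearMap.range_zero]
  have hk : LinearMap.ker (P.d (i + 1) i).hom = N :=
    le_antisymm (hker.trans (sup_le (hr.le.trans bot_le) le_rfl)) hNd
  obtain ⟨r, hr⟩ := (isFiniteSplit_d P hP hH ha i).exists_leftInverse (hk ▸ hN) (by
    exact (LinearMap.lTensor_inj_iff_rTensor_inj _ _).2 ((ModuleCat.mono_iff_injective _).1 hm))
  exact ⟨⟨ModuleCat.ofHom r, ModuleCat.hom_ext hr⟩⟩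

end Complexes

section Minimal

/-- The embedding of the degrees `≤ r`, numbered downwards from `r`. -/
def embeddingDownIntLE (r : ℤ) : (ComplexShape.up ℕ).Embedding (ComplexShape.down ℤ) :=
  .mk' _ _ (fun n => r - n) (fun _ _ h => by lia)
    (by simp only [ComplexShape.up_Rel, ComplexShape.down_Rel]; lia)

theorem embeddingDownIntLE_f (r : ℤ) (n : ℕ) : (embeddingDownIntLE r).f n = r - n := rfl

instance (r : ℤ) : (embeddingDownIntLE r).IsRelIff where
  rel' _ _ h := by
    rw [embeddingDownIntLE_f, embeddingDownIntLE_f, ComplexShape.down_Rel] at h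
    rw [ComplexShape.up_Rel]
    lia

theorem embeddingDownIntLE_f_toNat {r i : ℤ} (hi : i ≤ r) :
    (embeddingDownIntLE r).f (r - i).toNat = i := by
  rw [embeddingDownIntLE_f]; lia

instance (r : ℤ) : (embeddingDownIntLE r).IsTruncGE where
  mem_next {n i} h := ⟨n + 1, by
    rw [embeddingDownIntLE_f, ComplexShape.down_Rel] at h
    rw [embeddingDownIntLE_f]
    lia⟩

variable {C : Type u} [Category.{v} C] [Abelian C]

theorem projective_opcycles_of_isSplitMono (P : ChainComplex C ℤ) (r : ℤ)
    [IsSplitMono (P.d (r + 1) r)] [Projective (P.X r)] : Projective (P.opcycles r) := by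
  have h : P.d (r + 1) r ≫ (𝟙 _ - retraction (P.d (r + 1) r) ≫ P.d (r + 1) r) = 0 := by simp
  refine Retract.projective (Y := P.X r)
    { i := P.descOpcycles _ (r + 1) (by simp) h, r := P.pOpcycles r, retract := ?_ }
  rw [← cancel_epi (P.pOpcycles r)]
  simp

theorem isZero_homology_of_isZero_X {P : ChainComplex C ℤ} {i : ℤ} (hi : IsZero (P.X i)) :
    IsZero (P.homology i) := by
  rw [← HomologicalComplex.exactAt_iff_isZero_homology]
  exact ShortComplex.exact_of_isZero_X₂ _ hi

theorem exists_truncation (P : ChainComplex C ℤ) (hP : ∀ i, Projective (P.X i)) (r : ℤ)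
    [IsSplitMono (P.d (r + 1) r)] (hr : ∀ i, r < i → IsZero (P.homology i)) :
    ∃ P' : ChainComplex C ℤ, (∀ i, Projective (P'.X i)) ∧ (∀ i, r < i → IsZero (P'.X i)) ∧
      (∀ i, IsZero (P.X i) → IsZero (P'.X i)) ∧
      ∀ i, Nonempty (P'.homology i ≅ P.homology i) := by
  have hz (i : ℤ) (hi : r < i) : IsZero ((P.truncGE (embeddingDownIntLE r)).X i) :=
    HomologicalComplex.isZero_extend_X _ _ _ fun n => by
      rw [embeddingDownIntLE_f]; lia
  refine ⟨P.truncGE (embeddingDownIntLE r), fun i => ?_, hz,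
    fun i hi => hi.of_epi ((P.πTruncGE (embeddingDownIntLE r)).f i), fun i => ?_⟩
  · rcases lt_or_ge r i with hi | hi
    · exact Projective.of_iso (hz i hi).isoZero.symm inferInstance
    · by_cases hb : (embeddingDownIntLE r).BoundaryGE (r - i).toNat
      · obtain rfl : i = r := by
          by_contra hne
          refine hb.2 ((r - i).toNat - 1) ?_
          rw [embeddingDownIntLE_f, embeddingDownIntLE_f, ComplexShape.down_Rel]
          lia
        exact Projective.of_iso
          (P.truncGEXIsoOpcycles _ (embeddingDownIntLE_f_toNat hi) hb).symm
          (projective_opcycles_of_isSplitMono P i)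
      · exact Projective.of_iso (P.truncGEXIso _ (embeddingDownIntLE_f_toNat hi) hb).symm (hP i)
  · rcases lt_or_ge r i with hi | hi
    · refine ⟨IsZero.iso ?_ (hr i hi)⟩
      exact isZero_homology_of_isZero_X (hz i hi)
    · have := P.quasiIsoAt_πTruncGE (embeddingDownIntLE r) (embeddingDownIntLE_f_toNat hi)
      exact ⟨(isoOfQuasiIsoAt (P.πTruncGE (embeddingDownIntLE r)) i).symm⟩

theorem IsHSup.le_of_isSup {P : ChainComplex C ℤ} {s t : ℤ} (ht : IsHSup P t) (hs : IsSup P s) :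
    t ≤ s := by
  by_contra! h
  exact ht.1 (isZero_homology_of_isZero_X (hs.2 t h))

theorem qpd_le_of_isFiniteQuasiProjRes {M : C} {P : ChainComplex C ℤ} {s t : ℤ}
    (hP : IsFiniteQuasiProjRes M P) (hs : IsSup P s) (ht : IsHSup P t) :
    qpd M ≤ ((s - t).toNat : ℕ∞) := by
  unfold qpd
  split_ifs
  · exact zero_le
  · exact sInf_le ⟨P, s, t, hP, hs, ht, rfl⟩

theorem exists_isFiniteQuasiProjRes_eq_qpd {M : C} (hM : ¬ IsZero M) (h : qpd M < ⊤) :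
    ∃ (P : ChainComplex C ℤ) (s t : ℤ), IsFiniteQuasiProjRes M P ∧ IsSup P s ∧ IsHSup P t ∧
      qpd M = ((s - t).toNat : ℕ∞) := by
  unfold qpd at h ⊢
  rw [if_neg hM] at h ⊢
  refine csInf_mem (s := {d : ℕ∞ | ∃ (P : ChainComplex C ℤ) (s t : ℤ),
    IsFiniteQuasiProjRes M P ∧ IsSup P s ∧ IsHSup P t ∧ d = ((s - t).toNat : ℕ∞)})
    (Set.nonempty_iff_ne_empty.2 fun h₀ => ?_)
  rw [h₀, sInf_empty] at h
  exact lt_irrefl _ h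

/-- A quasi-projective resolution computing the quasi-projective dimension has no split
monomorphism as its leftmost differential. -/
theorem not_isSplitMono_of_eq_qpd {M : C} {P : ChainComplex C ℤ} {r t : ℤ}
    (hP : IsFiniteQuasiProjRes M P) (hs : IsSup P (r + 1)) (ht : IsHSup P t)
    (h : qpd M = ((r + 1 - t).toNat : ℕ∞)) : ¬ IsSplitMono (P.d (r + 1) r) := by
  intro _
  have hr : IsZero (P.homology (r + 1)) := by
    rw [← HomologicalComplex.exactAt_iff_isZero_homology,
      P.exactAt_iff' (r + 1 + 1) (r + 1) r (by simp) (by simp)]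
    rw [ShortComplex.exact_iff_mono _ ((hs.2 _ (by lia)).eq_of_src _ _)]
    exact inferInstanceAs (Mono (P.d (r + 1) r))
  have htr : t ≤ r := by
    have := ht.le_of_isSup hs
    by_contra! h'
    obtain rfl : t = r + 1 := by lia
    exact ht.1 hr
  obtain ⟨P', h₁, h₂, h₃, h₄⟩ := exists_truncation P hP.projective r fun i hi => by
    rcases eq_or_ne i (r + 1) with rfl | hi'
    · exact hr
    · exact ht.2 i (by lia)
  have ht' : IsHSup P' t :=
    ⟨fun hz => ht.1 (hz.of_iso (h₄ t).some.symm), fun i hi => (ht.2 i hi).of_iso (h₄ i).some⟩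
  obtain ⟨s, hs₁, hs₂⟩ := Int.exists_greatest_of_bdd (P := fun i => ¬ IsZero (P'.X i))
    ⟨r, fun i hi => by by_contra! h'; exact hi (h₂ i h')⟩
    ⟨t, fun hz => ht'.1 (isZero_homology_of_isZero_X hz)⟩
  have hs' : IsSup P' s := ⟨hs₁, fun i hi => by
    by_contra h'
    exact absurd (hs₂ i h') (by lia)⟩
  have hP' : IsFiniteQuasiProjRes M P' :=
    { projective := h₁
      bddBelow := hP.bddBelow.imp fun a ha i hi => h₃ i (ha i hi)
      homology_iso := by
        obtain ⟨m, hm, h⟩ := hP.homology_iso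
        exact ⟨m, hm, fun j => ⟨(h₄ j).some ≪≫ (h j).some⟩⟩
      bddAbove := ⟨r, h₂⟩ }
  have hle := qpd_le_of_isFiniteQuasiProjRes hP' hs' ht'
  have hsr : s ≤ r := by
    by_contra! h'
    exact hs₁ (h₂ s h')
  have := ht'.le_of_isSup hs'
  rw [h, Nat.cast_le] at hle
  lia

end Minimal

section MinimalLocal

open IsLocalRing MonoidalCategory

variable {R : Type u} [CommRing R] [IsNoetherianRing R] [IsLocalRing R]

instance (M : ModuleCat.{u} R) [Module.Finite R M] (n : ℕ) :
    Module.Finite R (copies M n : ModuleCat.{u} R) :=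
  Module.Finite.equiv (ModuleCat.biproductIsoPi fun _ : Fin n => M).symm.toLinearEquiv

theorem not_mono_d_whiskerRight_of_eq_qpd {M : ModuleCat.{u} R} [Module.Finite R M]
    {P : ChainComplex (ModuleCat.{u} R) ℤ} {r t : ℤ}
    (hP : IsFiniteQuasiProjRes M P) (hs : IsSup P (r + 1)) (ht : IsHSup P t)
    (h : qpd M = ((r + 1 - t).toNat : ℕ∞)) :
    ¬ Mono (P.d (r + 1) r ▷ ModuleCat.of R (ResidueField R)) := by
  intro hm
  obtain ⟨a, ha⟩ := hP.bddBelow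
  obtain ⟨m, -, hm'⟩ := hP.homology_iso
  exact not_isSplitMono_of_eq_qpd hP hs ht h (isSplitMono_d_of_mono_whiskerRight P hP.projective
    (fun j => Module.Finite.equiv (hm' j).some.symm.toLinearEquiv) ha (hs.2 _ (by lia)) hm)

end MinimalLocal

section TensorHomology

open MonoidalCategory

variable {R : Type u} [CommRing R] {N : ModuleCat.{u} R} (Q : ProjectiveResolution N)

/-- Tensoring a projective resolution, as a functor of the left factor. -/
noncomputable def tensorResolution : ModuleCat.{u} R ⥤ ChainComplex (ModuleCat.{u} R) ℕ where
  obj L := ((tensoringLeft (ModuleCat.{u} R)).obj L).mapHomologicalComplex _ |>.obj Q.complex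
  map f := (NatTrans.mapHomologicalComplex ((tensoringLeft (ModuleCat.{u} R)).map f) _).app Q.complex

instance : (tensorResolution Q).Additive where
  map_add {X Y f g} := by
    ext i : 1
    exact MonoidalPreadditive.add_whiskerRight f g

/-- The homology of a module tensored with a projective resolution of `N`,
as a functor of that module. -/
noncomputable def tensorHomology (i : ℕ) : ModuleCat.{u} R ⥤ ModuleCat.{u} R :=
  tensorResolution Q ⋙ HomologicalComplex.homologyFunctor _ _ i

instance (i : ℕ) : (tensorHomology Q i).Additive := by
  unfold tensorHomology
  infer_instance

/-- The homology of a module tensored with a projective resolution is `Tor`. -/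
noncomputable def tensorHomologyIsoTor (i : ℕ) (L : ModuleCat.{u} R) :
    (tensorHomology Q i).obj L ≅ ((Tor (ModuleCat.{u} R) i).obj L).obj N :=
  (Q.isoLeftDerivedObj ((tensoringLeft (ModuleCat.{u} R)).obj L) i).symm

instance (i : ℕ) : Module.Flat R (Q.complex.X i) :=
  have : Module.Projective R (Q.complex.X i) := (IsProjective.iff_projective _).2 (Q.projective i)
  inferInstance

theorem shortExact_map_tensorResolution {S : ShortComplex (ModuleCat.{u} R)} (hS : S.ShortExact) :
    (S.map (tensorResolution Q)).ShortExact :=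
  HomologicalComplex.shortExact_of_degreewise_shortExact _ fun i =>
    hS.map_of_exact (tensorRight (Q.complex.X i))

theorem isZero_tensorHomology_of_flat (L : ModuleCat.{u} R) [Module.Flat R L] (i : ℕ) :
    IsZero ((tensorHomology Q (i + 1)).obj L) := by
  refine (HomologicalComplex.exactAt_iff_isZero_homology _ _).1 ?_
  exact (Q.complex_exactAt_succ i).map (tensorLeft L)

variable {S : ShortComplex (ModuleCat.{u} R)} {i : ℕ}

theorem isZero_tensorHomology_X₂ (hS : S.ShortExact)
    (h₁ : IsZero ((tensorHomology Q i).obj S.X₁))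
    (h₃ : IsZero ((tensorHomology Q i).obj S.X₃)) : IsZero ((tensorHomology Q i).obj S.X₂) :=
  ((shortExact_map_tensorResolution Q hS).homology_exact₂ i).isZero_of_both_zeros
    (h₁.eq_of_src _ _) (h₃.eq_of_tgt _ _)

theorem isZero_tensorHomology_X₁ (hS : S.ShortExact)
    (h₂ : IsZero ((tensorHomology Q i).obj S.X₂))
    (h₃ : IsZero ((tensorHomology Q (i + 1)).obj S.X₃)) :
    IsZero ((tensorHomology Q i).obj S.X₁) :=
  ((shortExact_map_tensorResolution Q hS).homology_exact₁ (i + 1) i rfl).isZero_of_both_zeros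
    (h₃.eq_of_src _ _) (h₂.eq_of_tgt _ _)

theorem nonempty_iso_of_isZero_tensorHomology_X₂ (hS : S.ShortExact)
    (h : IsZero ((tensorHomology Q i).obj S.X₂))
    (h' : IsZero ((tensorHomology Q (i + 1)).obj S.X₂)) :
    Nonempty ((tensorHomology Q (i + 1)).obj S.X₃ ≅ (tensorHomology Q i).obj S.X₁) := by
  have hS' := shortExact_map_tensorResolution Q hS
  have : Mono (hS'.δ (i + 1) i rfl) :=
    (hS'.homology_exact₃ (i + 1) i rfl).mono_g (h'.eq_of_src _ _)
  have : Epi (hS'.δ (i + 1) i rfl) :=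
    (hS'.homology_exact₁ (i + 1) i rfl).epi_f (h.eq_of_tgt _ _)
  exact ⟨@asIso _ _ _ _ _ (isIso_of_mono_of_epi (hS'.δ (i + 1) i rfl))⟩

theorem nonempty_iso_of_isZero_tensorHomology_X₃ (hS : S.ShortExact)
    (h : IsZero ((tensorHomology Q i).obj S.X₃))
    (h' : IsZero ((tensorHomology Q (i + 1)).obj S.X₃)) :
    Nonempty ((tensorHomology Q i).obj S.X₁ ≅ (tensorHomology Q i).obj S.X₂) := by
  have hS' := shortExact_map_tensorResolution Q hS
  have : Mono ((tensorHomology Q i).map S.f) :=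
    (hS'.homology_exact₁ (i + 1) i rfl).mono_g (h'.eq_of_src _ _)
  have : Epi ((tensorHomology Q i).map S.f) :=
    (hS'.homology_exact₂ i).epi_f (h.eq_of_tgt _ _)
  have := isIso_of_mono_of_epi ((tensorHomology Q i).map S.f)
  exact ⟨asIso ((tensorHomology Q i).map S.f)⟩

theorem exists_mono_exact_tensorHomology (hS : S.ShortExact)
    (h : IsZero ((tensorHomology Q (i + 1)).obj S.X₂)) :
    ∃ (δ : (tensorHomology Q (i + 1)).obj S.X₃ ⟶ (tensorHomology Q i).obj S.X₁)
      (w : δ ≫ (tensorHomology Q i).map S.f = 0), Mono δ ∧ (ShortComplex.mk _ _ w).Exact := by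
  have hS' := shortExact_map_tensorResolution Q hS
  exact ⟨hS'.δ (i + 1) i rfl, hS'.δ_comp (i + 1) i rfl,
    (hS'.homology_exact₃ (i + 1) i rfl).mono_g (h.eq_of_src _ _),
    hS'.homology_exact₁ (i + 1) i rfl⟩

/-- The degree zero part of `tensorHomologyZeroIso`, at a module `L`. -/
noncomputable def opcyclesTensorResolutionIso (L : ModuleCat.{u} R) :
    ((tensorResolution Q).obj L).opcycles 0 ≅ (tensorRight N).obj L :=
  (((tensorResolution Q).obj L).opcyclesIsCokernel 1 0 (by simp)).coconePointUniqueUpToIso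
    (Q.cokernelCofork.mapIsColimit Q.isColimitCokernelCofork (tensorLeft L))

theorem pOpcycles_opcyclesTensorResolutionIso_hom (L : ModuleCat.{u} R) :
    ((tensorResolution Q).obj L).pOpcycles 0 ≫ (opcyclesTensorResolutionIso Q L).hom =
      (tensorLeft L).map (Q.π.f 0) :=
  IsColimit.comp_coconePointUniqueUpToIso_hom
    (((tensorResolution Q).obj L).opcyclesIsCokernel 1 0 (by simp)) _ WalkingParallelPair.one

/-- In degree zero, the homology of a module tensored with a projective resolution of `N`
is the tensor product with `N`. -/
noncomputable def tensorHomologyZeroIso : tensorHomology Q 0 ≅ tensorRight N :=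
  NatIso.ofComponents
    (fun L => ChainComplex.isoHomologyι₀ _ ≪≫ opcyclesTensorResolutionIso Q L)
    fun {L L'} f => by
      have h : HomologicalComplex.opcyclesMap ((tensorResolution Q).map f) 0 ≫
          (opcyclesTensorResolutionIso Q L').hom =
          (opcyclesTensorResolutionIso Q L).hom ≫ (tensorRight N).map f := by
        rw [← cancel_epi (HomologicalComplex.pOpcycles _ _),
          HomologicalComplex.p_opcyclesMap_assoc, pOpcycles_opcyclesTensorResolutionIso_hom,
          ← Category.assoc, pOpcycles_opcyclesTensorResolutionIso_hom]
        exact (whisker_exchange f (Q.π.f 0)).symm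
      have h' := HomologicalComplex.homologyι_naturality ((tensorResolution Q).map f) 0
      exact (Category.assoc _ _ _).symm.trans <| (congrArg (· ≫ _) h').trans <|
        (Category.assoc _ _ _).trans <| (congrArg (_ ≫ ·) h).trans (Category.assoc _ _ _).symm

end TensorHomology

section TensorHomologyZero

open MonoidalCategory

variable {R : Type u} [CommRing R] {N : ModuleCat.{u} R} (Q : ProjectiveResolution N)

theorem shortExact_map_tensorHomology_zero {S : ShortComplex (ModuleCat.{u} R)}
    (hS : S.ShortExact) (h : IsZero ((tensorHomology Q 1).obj S.X₃)) :
    (S.map (tensorHomology Q 0)).ShortExact := by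
  have hS' := shortExact_map_tensorResolution Q hS
  have hg : Epi (S.g ▷ N) := (ModuleCat.epi_iff_surjective _).2
    (LinearMap.rTensor_surjective N ((ModuleCat.epi_iff_surjective _).1 hS.epi_g))
  have : Epi ((tensorRight N).map S.g) := hg
  exact
    { exact := hS'.homology_exact₂ 0
      mono_f := (hS'.homology_exact₁ 1 0 rfl).mono_g (h.eq_of_src _ _)
      epi_g := ((MorphismProperty.epimorphisms _).arrow_mk_iso_iff
        (Arrow.isoMk ((tensorHomologyZeroIso Q).app _) ((tensorHomologyZeroIso Q).app _)
          ((tensorHomologyZeroIso Q).hom.naturality S.g).symm)).2 this }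

end TensorHomologyZero

section Copies

variable {C D : Type*} [Category C] [Abelian C] [Category D] [Preadditive D]

theorem isZero_map_copies (F : C ⥤ D) [F.Additive] {M : C} (h : IsZero (F.obj M)) (n : ℕ) :
    IsZero (F.obj (copies M n)) := by
  rw [IsZero.iff_id_eq_zero, ← F.map_id, copies, ← biproduct.total, F.map_sum]
  refine Finset.sum_eq_zero fun i _ => ?_
  rw [F.map_comp, h.eq_of_tgt (F.map (biproduct.π (fun _ => M) i)) 0, zero_comp]

theorem isZero_map_of_copies (F : C ⥤ D) [F.Additive] {M : C} {n : ℕ} (hn : n ≠ 0)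
    (h : IsZero (F.obj (copies M n))) : IsZero (F.obj M) := by
  have i : Fin n := ⟨0, Nat.pos_of_ne_zero hn⟩
  have : biproduct.ι (fun _ => M) i ≫ biproduct.π (fun _ => M) i = 𝟙 M := biproduct.ι_π_self _ i
  have h₀ : F.map (biproduct.ι (fun _ : Fin n => M) i) = 0 := h.eq_of_tgt _ _
  rw [IsZero.iff_id_eq_zero, ← F.map_id, ← this, F.map_comp, h₀, zero_comp]

variable {R : Type u} [CommRing R] [IsLocalRing R]

theorem le_depth_iff_isZero (X : ModuleCat.{u} R) (n : ℕ) :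
    (n : ℕ∞) ≤ depth X ↔ ∀ i < n, IsZero
      ((Abelian.extFunctorObj (ModuleCat.of R (IsLocalRing.ResidueField R)) i).obj X) := by
  rw [le_depth_iff]
  refine forall₂_congr fun i _ => ⟨fun h => ?_, fun h => ?_⟩
  · exact AddCommGrpCat.isZero_of_subsingleton (AddCommGrpCat.of (Abelian.Ext _ X i))
  · exact AddCommGrpCat.subsingleton_of_isZero h

theorem le_depth_map_copies (F : ModuleCat.{u} R ⥤ ModuleCat.{u} R) [F.Additive]
    {M : ModuleCat.{u} R} {n : ℕ} (h : (n : ℕ∞) ≤ depth (F.obj M)) (m : ℕ) :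
    (n : ℕ∞) ≤ depth (F.obj (copies M m)) :=
  (le_depth_iff_isZero _ _).2 fun i hi =>
    isZero_map_copies (F ⋙ Abelian.extFunctorObj _ i) ((le_depth_iff_isZero _ _).1 h i hi) m

theorem depth_map_copies (F : ModuleCat.{u} R ⥤ ModuleCat.{u} R) [F.Additive]
    (M : ModuleCat.{u} R) {m : ℕ} (hm : m ≠ 0) :
    depth (F.obj (copies M m)) = depth (F.obj M) := by
  refine ENat.eq_of_forall_natCast_le_iff fun n => ⟨fun h => ?_, fun h => le_depth_map_copies F h m⟩
  exact (le_depth_iff_isZero _ _).2 fun i hi => isZero_map_of_copies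
    (F ⋙ Abelian.extFunctorObj _ i) hm ((le_depth_iff_isZero _ _).1 h i hi)

theorem _root_.CategoryTheory.Iso.depth_eq {X Y : ModuleCat.{u} R} (e : X ≅ Y) :
    depth X = depth Y :=
  ENat.eq_of_forall_natCast_le_iff fun n => by
    simp only [le_depth_iff_isZero]
    exact forall₂_congr fun i _ => ((Abelian.extFunctorObj _ i).mapIso e).isZero_iff

end Copies

section Opcycles

variable {C : Type*} [Category C] [Abelian C] (P : ChainComplex C ℤ) {i j : ℤ}

theorem shortExact_homology_opcycles (hij : j + 1 = i) :
    (ShortComplex.mk (P.homologyι i) (factorThruImage (P.fromOpcycles i j))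
      (by simp [← cancel_mono (image.ι (P.fromOpcycles i j))])).ShortExact := by
  have hi : (ComplexShape.down ℤ).next i = j := (ComplexShape.down ℤ).next_eq' hij
  let φ : ShortComplex.mk (P.homologyι i) (factorThruImage (P.fromOpcycles i j))
      (by simp [← cancel_mono (image.ι (P.fromOpcycles i j))]) ⟶
      ShortComplex.mk _ _ (P.homologyι_comp_fromOpcycles i j) :=
    { τ₁ := 𝟙 _, τ₂ := 𝟙 _, τ₃ := image.ι _ }
  have : IsIso φ.τ₂ := inferInstanceAs (IsIso (𝟙 _))
  have : Epi φ.τ₁ := inferInstanceAs (Epi (𝟙 _))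
  have : Mono φ.τ₃ := inferInstanceAs (Mono (image.ι _))
  exact
    { exact := (ShortComplex.exact_iff_of_epi_of_isIso_of_mono φ).2
        (ShortComplex.exact_of_f_is_kernel _ (P.homologyIsKernel i j hi))
      mono_f := inferInstanceAs (Mono (P.homologyι i))
      epi_g := inferInstanceAs (Epi (factorThruImage _)) }

theorem image_ι_comp_pOpcycles (i j : ℤ) :
    image.ι (P.fromOpcycles i j) ≫ P.pOpcycles j = 0 := by
  rw [← cancel_epi (factorThruImage (P.fromOpcycles i j)), ← cancel_epi (P.pOpcycles i)]
  simp

theorem shortExact_image_opcycles (hij : j + 1 = i) :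
    (ShortComplex.mk _ _ (image_ι_comp_pOpcycles P i j)).ShortExact := by
  have hj : (ComplexShape.down ℤ).prev j = i := (ComplexShape.down ℤ).prev_eq' hij
  let φ : ShortComplex.mk _ _ (P.d_pOpcycles i j) ⟶
      ShortComplex.mk _ _ (image_ι_comp_pOpcycles P i j) :=
    { τ₁ := P.pOpcycles i ≫ factorThruImage _, τ₂ := 𝟙 _, τ₃ := 𝟙 _ }
  have : IsIso φ.τ₂ := inferInstanceAs (IsIso (𝟙 _))
  have : Epi φ.τ₁ := inferInstanceAs (Epi (_ ≫ _))
  have : Mono φ.τ₃ := inferInstanceAs (Mono (𝟙 _))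
  exact
    { exact := (ShortComplex.exact_iff_of_epi_of_isIso_of_mono φ).1
        (ShortComplex.exact_of_g_is_cokernel _ (P.opcyclesIsCokernel i j hj))
      mono_f := inferInstanceAs (Mono (image.ι _))
      epi_g := inferInstanceAs (Epi (P.pOpcycles j)) }

theorem fromOpcycles_comp_pOpcycles (i j : ℤ) : P.fromOpcycles i j ≫ P.pOpcycles j = 0 := by
  rw [← cancel_epi (P.pOpcycles i)]
  simp

theorem shortExact_fromOpcycles (hij : j + 1 = i) (h : IsZero (P.homology i)) :
    (ShortComplex.mk _ _ (fromOpcycles_comp_pOpcycles P i j)).ShortExact := by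
  have hf := (shortExact_homology_opcycles P hij).exact.mono_g (h.eq_of_src _ _)
  let φ : ShortComplex.mk _ _ (fromOpcycles_comp_pOpcycles P i j) ⟶
      ShortComplex.mk _ _ (image_ι_comp_pOpcycles P i j) :=
    { τ₁ := factorThruImage _, τ₂ := 𝟙 _, τ₃ := 𝟙 _ }
  have : IsIso φ.τ₂ := inferInstanceAs (IsIso (𝟙 _))
  have : Epi φ.τ₁ := inferInstanceAs (Epi (factorThruImage _))
  have : Mono φ.τ₃ := inferInstanceAs (Mono (𝟙 _))
  have hS := shortExact_image_opcycles P hij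
  exact
    { exact := (ShortComplex.exact_iff_of_epi_of_isIso_of_mono φ).2 hS.exact
      mono_f := by
        have : Mono (factorThruImage (P.fromOpcycles i j)) := hf
        dsimp
        rw [← image.fac (P.fromOpcycles i j)]
        exact mono_comp _ _
      epi_g := hS.epi_g }

end Opcycles

section TensorOpcycles

open MonoidalCategory

variable {R : Type u} [CommRing R] {N : ModuleCat.{u} R} (Q : ProjectiveResolution N)
  {P : ChainComplex (ModuleCat.{u} R) ℤ}

theorem forall_opcycles (hb : ∃ a : ℤ, ∀ i, i < a → IsZero (P.X i)) {p : ModuleCat.{u} R → Prop}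
    (h₀ : ∀ X, IsZero X → p X) (h₁ : ∀ j, p (P.opcycles j) → p (P.opcycles (j + 1))) (j : ℤ) :
    p (P.opcycles j) := by
  obtain ⟨a, ha⟩ := hb
  have h (j : ℤ) (hj : j < a) : p (P.opcycles j) :=
    h₀ _ (IsZero.of_epi (P.pOpcycles j) (ha j hj))
  obtain hj | hj := lt_or_ge j a
  · exact h j hj
  · induction j, hj using Int.leInduction with
    | base => simpa using h₁ (a - 1) (h _ (by lia))
    | succ j hj ih => exact h₁ j ih

variable [∀ i, Module.Flat R (P.X i)]

theorem isZero_tensorHomology_image {i j : ℤ} (hij : j + 1 = i) {n : ℕ}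
    (h : IsZero ((tensorHomology Q (n + 2)).obj (P.opcycles j))) :
    IsZero ((tensorHomology Q (n + 1)).obj (image (P.fromOpcycles i j))) :=
  isZero_tensorHomology_X₁ Q (shortExact_image_opcycles P hij)
    (isZero_tensorHomology_of_flat Q (P.X j) n) h

theorem isZero_tensorHomology_opcycles (hb : ∃ a : ℤ, ∀ i, i < a → IsZero (P.X i)) {q : ℕ}
    (hH : ∀ j i, q < i → IsZero ((tensorHomology Q i).obj (P.homology j))) (j : ℤ) :
    ∀ i, q < i → IsZero ((tensorHomology Q i).obj (P.opcycles j)) := by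
  refine forall_opcycles hb (p := fun X => ∀ i, q < i → IsZero ((tensorHomology Q i).obj X))
    (fun X hX i _ => (tensorHomology Q i).map_isZero hX) (fun j hj i hi => ?_) j
  obtain ⟨i, rfl⟩ := Nat.exists_eq_succ_of_ne_zero (Nat.ne_zero_of_lt hi)
  exact isZero_tensorHomology_X₂ Q (shortExact_homology_opcycles P rfl) (hH _ _ hi)
    (isZero_tensorHomology_image Q rfl (hj _ (by lia)))

theorem le_depth_tensorHomology_zero_opcycles [IsLocalRing R]
    (hb : ∃ a : ℤ, ∀ i, i < a → IsZero (P.X i))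
    (hH : ∀ j i, 0 < i → IsZero ((tensorHomology Q i).obj (P.homology j))) {n : ℕ}
    (hP : ∀ j, n ≤ depth ((tensorHomology Q 0).obj (P.X j)))
    (hH₀ : ∀ j, n ≤ depth ((tensorHomology Q 0).obj (P.homology j))) (j : ℤ) :
    n ≤ depth ((tensorHomology Q 0).obj (P.opcycles j)) := by
  have hO := isZero_tensorHomology_opcycles Q hb hH
  simp only [le_depth_iff] at hP hH₀ ⊢
  refine forall_opcycles hb (p := fun X => ∀ i < n, Subsingleton (Abelian.Ext
      (ModuleCat.of R (IsLocalRing.ResidueField R)) ((tensorHomology Q 0).obj X) i))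
    (fun X hX i _ => ((tensorHomology Q 0).map_isZero hX).subsingleton_ext _ _)
    (fun j hj i hi => ?_) j
  have h₁ := shortExact_map_tensorHomology_zero Q (shortExact_homology_opcycles P (j := j) rfl)
    (isZero_tensorHomology_image Q rfl (hO j 2 two_pos))
  have h₂ := shortExact_map_tensorHomology_zero Q (shortExact_image_opcycles P (j := j) rfl)
    (hO j 1 one_pos)
  exact h₁.subsingleton_ext₂ _ i (hH₀ _ i hi)
    (h₂.subsingleton_ext₁ _ i (hP j i hi) fun m hm => hj m (by lia))

theorem nonempty_tensorHomology_opcycles_iso {t : ℤ} (ht : ∀ i, t < i → IsZero (P.homology i))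
    (a b c : ℕ) (j : ℤ) (hc : c = b + 1 + a) (hj : j = t + a) :
    Nonempty ((tensorHomology Q c).obj (P.opcycles t) ≅
      (tensorHomology Q (b + 1)).obj (P.opcycles j)) := by
  subst hc hj
  induction a generalizing b with
  | zero => simpa using ⟨Iso.refl _⟩
  | succ a ih =>
    obtain ⟨e⟩ := ih (b + 1)
    obtain ⟨e'⟩ := nonempty_iso_of_isZero_tensorHomology_X₂ Q
      (shortExact_fromOpcycles P (j := t + a) rfl (ht _ (by lia)))
      (isZero_tensorHomology_of_flat Q (P.X (t + a)) b)
      (isZero_tensorHomology_of_flat Q (P.X (t + a)) (b + 1))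
    rw [show b + 1 + (a + 1) = b + 1 + 1 + a by lia,
      show t + ((a + 1 : ℕ) : ℤ) = t + a + 1 by push_cast; ring]
    exact ⟨e ≪≫ e'⟩

variable [IsNoetherianRing R] [IsLocalRing R] [Module.Finite R N]

theorem le_depth_tensorHomology_zero (L : ModuleCat.{u} R) [Module.Flat R L] {n : ℕ}
    (h : n ≤ depth N) : n ≤ depth ((tensorHomology Q 0).obj L) := by
  rw [((tensorHomologyZeroIso Q).app L).depth_eq]
  rw [le_depth_iff] at h ⊢
  exact subsingleton_ext_tensor _ L N n h

theorem exists_ext_comp_fromOpcycles_eq_zero {i j : ℤ} [IsIso (P.pOpcycles i)]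
    (hd : ¬ Mono (P.d i j ▷ ModuleCat.of R (IsLocalRing.ResidueField R))) {D : ℕ}
    (hD : depth N = D) :
    ∃ x : Abelian.Ext (ModuleCat.of R (IsLocalRing.ResidueField R))
        ((tensorHomology Q 0).obj (P.opcycles i)) D, x ≠ 0 ∧
      x.comp (Abelian.Ext.mk₀ ((tensorHomology Q 0).map (P.fromOpcycles i j))) (add_zero D) = 0 := by
  have h₁ := (le_depth_iff N D).1 hD.ge
  have h₂ : ¬ Subsingleton (Abelian.Ext (ModuleCat.of R (IsLocalRing.ResidueField R)) N D) := by
    intro h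
    have := (le_depth_iff N (D + 1)).2 fun i hi => by
      obtain hi | rfl := Nat.lt_succ_iff_lt_or_eq.1 hi
      exacts [h₁ i hi, h]
    rw [hD] at this
    exact absurd (Nat.cast_le.1 this) (by lia)
  obtain ⟨x, hx, hx'⟩ := exists_ext_comp_whiskerRight_eq_zero N (P.X i) (P.X j) (P.d i j) hd D h₁ h₂
  let e : P.X i ⊗ N ≅ (tensorHomology Q 0).obj (P.opcycles i) :=
    ((tensorHomologyZeroIso Q).app (P.X i)).symm ≪≫
      (tensorHomology Q 0).mapIso (asIso (P.pOpcycles i))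
  have he : e.hom ≫ (tensorHomology Q 0).map (P.fromOpcycles i j) =
      (P.d i j ▷ N) ≫ (tensorHomologyZeroIso Q).inv.app (P.X j) := by
    refine .trans ?_ ((tensorHomologyZeroIso Q).inv.naturality (P.d i j)).symm
    rw [← P.p_fromOpcycles, Functor.map_comp, ← Category.assoc]
    rfl
  refine ⟨x.comp (Abelian.Ext.mk₀ e.hom) (add_zero D), fun h => hx ?_, ?_⟩
  · have : (x.comp (Abelian.Ext.mk₀ e.hom) (add_zero D)).comp
        (Abelian.Ext.mk₀ e.inv) (add_zero D) = x := by simp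
    rw [← this, h, Abelian.Ext.zero_comp]
  · rw [Abelian.Ext.comp_assoc_of_third_deg_zero, Abelian.Ext.mk₀_comp_mk₀, he,
      ← Abelian.Ext.mk₀_comp_mk₀, ← Abelian.Ext.comp_assoc_of_third_deg_zero, hx',
      Abelian.Ext.zero_comp]

end TensorOpcycles

section DepthFormula

open MonoidalCategory

variable {R : Type u} [CommRing R] [IsNoetherianRing R] [IsLocalRing R] {N : ModuleCat.{u} R}
  [Module.Finite R N] (Q : ProjectiveResolution N) {P : ChainComplex (ModuleCat.{u} R) ℤ}
  [∀ i, Module.Flat R (P.X i)]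

/-- The spliced exact sequence attached to the exact part of a complex of flat modules
computes depths. -/
theorem depth_eq_depth_add_of_opcycles {s m l : ℤ} {L : ℕ} (hm : m = s - L) (hl : l + 1 = m)
    (hs : ∀ i, s < i → IsZero (P.X i))
    (hd : ∀ i j, i = s → j + 1 = i →
      ¬ Mono (P.d i j ▷ ModuleCat.of R (IsLocalRing.ResidueField R)))
    (hH : ∀ i, m < i → IsZero (P.homology i))
    (hO : ∀ i, m ≤ i → IsZero ((tensorHomology Q 1).obj (P.opcycles i)))
    {T I C : ModuleCat.{u} R} {i : T ⟶ (tensorHomology Q 0).obj (P.opcycles m)}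
    {f : (tensorHomology Q 0).obj (P.opcycles m) ⟶ I}
    {g : I ⟶ (tensorHomology Q 0).obj (P.X l)} {h : (tensorHomology Q 0).obj (P.X l) ⟶ C}
    {w₁ : i ≫ f = 0} {w₂ : g ≫ h = 0}
    (hu : f ≫ g = (tensorHomology Q 0).map (P.fromOpcycles m l))
    (h₁ : (ShortComplex.mk i f w₁).ShortExact) (h₂ : (ShortComplex.mk g h w₂).ShortExact)
    (hC : ∀ n : ℕ, n ≤ depth N → (n + 1 : ℕ) ≤ depth T → n ≤ depth C) :
    depth N = depth T + L := by
  obtain rfl : l = s - ((L + 1 : ℕ) : ℤ) := by push_cast; lia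
  subst hm
  have hp : IsIso (P.pOpcycles (s - ((0 : ℕ) : ℤ))) :=
    P.isIso_pOpcycles _ _ rfl ((hs _ (by simp)).eq_of_src _ _)
  refine depth_eq_depth_add_of_spliced
    (A := fun n => (tensorHomology Q 0).obj (P.opcycles (s - (n : ℤ))))
    (Y := fun n => (tensorHomology Q 0).obj (P.X (s - ((n + 1 : ℕ) : ℤ))))
    (u := fun n => (tensorHomology Q 0).map (P.fromOpcycles _ _))
    (p := fun n => (tensorHomology Q 0).map (P.pOpcycles _))
    (w := fun n => ((tensorHomology Q 0).map_comp _ _).symm.trans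
      ((congrArg _ (fromOpcycles_comp_pOpcycles P _ _)).trans ((tensorHomology Q 0).map_zero _ _)))
    (fun n hn => ?_) hu h₁ h₂ (fun n hn => ?_) (fun n hn k => le_depth_tensorHomology_zero Q _ hn)
    (fun D hD => exists_ext_comp_fromOpcycles_eq_zero Q (hd _ _ (by simp) (by simp)) hD) hC
  · exact shortExact_map_tensorHomology_zero Q
      (shortExact_fromOpcycles P (by push_cast; ring) (hH _ (by lia))) (hO _ (by lia))
  · rw [← ((tensorHomology Q 0).mapIso (asIso (P.pOpcycles (s - ((0 : ℕ) : ℤ))))).depth_eq]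
    exact le_depth_tensorHomology_zero Q _ hn

theorem depth_eq_depth_tensorHomology_zero_add {s t : ℤ} {L : ℕ} (ht : t = s - L)
    (hb : ∃ a : ℤ, ∀ i, i < a → IsZero (P.X i)) (hs : ∀ i, s < i → IsZero (P.X i))
    (hd : ∀ i j, i = s → j + 1 = i →
      ¬ Mono (P.d i j ▷ ModuleCat.of R (IsLocalRing.ResidueField R)))
    (hH : ∀ i, t < i → IsZero (P.homology i))
    (hT : ∀ j i, 0 < i → IsZero ((tensorHomology Q i).obj (P.homology j)))
    (hT₀ : ∀ (j : ℤ) (n : ℕ), n ≤ depth ((tensorHomology Q 0).obj (P.homology t)) →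
      n ≤ depth ((tensorHomology Q 0).obj (P.homology j))) :
    depth N = depth ((tensorHomology Q 0).obj (P.homology t)) + L := by
  have hO := isZero_tensorHomology_opcycles Q hb hT
  have hl := sub_add_cancel t 1
  have h₁ := shortExact_map_tensorHomology_zero Q (shortExact_homology_opcycles P hl)
    (isZero_tensorHomology_image Q hl (hO _ 2 two_pos))
  have h₂ := shortExact_map_tensorHomology_zero Q (shortExact_image_opcycles P hl)
    (hO _ 1 one_pos)
  have hu : (tensorHomology Q 0).map (factorThruImage (P.fromOpcycles t (t - 1))) ≫
      (tensorHomology Q 0).map (image.ι (P.fromOpcycles t (t - 1))) =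
      (tensorHomology Q 0).map (P.fromOpcycles t (t - 1)) := by
    rw [← Functor.map_comp, image.fac]
  exact depth_eq_depth_add_of_opcycles Q ht hl hs hd hH (fun i _ => hO i 1 one_pos) hu h₁ h₂
    fun n hn hn' => le_depth_tensorHomology_zero_opcycles Q hb hT
      (fun j => le_depth_tensorHomology_zero Q _ hn)
      (fun j => hT₀ j n (le_trans (by exact_mod_cast n.le_succ) hn')) _

theorem depth_eq_depth_tensorHomology_opcycles_add {s m l : ℤ} {L : ℕ} (hm : m = s - L)
    (hl : l + 1 = m) (hs : ∀ i, s < i → IsZero (P.X i))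
    (hd : ∀ i j, i = s → j + 1 = i →
      ¬ Mono (P.d i j ▷ ModuleCat.of R (IsLocalRing.ResidueField R)))
    (hH : ∀ i, l < i → IsZero (P.homology i))
    (hO : ∀ i, m ≤ i → IsZero ((tensorHomology Q 1).obj (P.opcycles i)))
    (hT : depth ((tensorHomology Q 1).obj (P.opcycles l)) ≤ 1) :
    depth N = depth ((tensorHomology Q 1).obj (P.opcycles l)) + L := by
  obtain ⟨δ, w, hδ, hex⟩ := exists_mono_exact_tensorHomology Q
    (shortExact_fromOpcycles P hl (hH m (by lia))) (i := 0)
    (isZero_tensorHomology_of_flat Q (P.X l) 0)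
  let φ := (tensorHomology Q 0).map (P.fromOpcycles m l)
  have w₁ : δ ≫ factorThruImage φ = 0 := by
    rw [← cancel_mono (image.ι φ), Category.assoc, image.fac, zero_comp]
    exact w
  let ψ : ShortComplex.mk _ _ w₁ ⟶ ShortComplex.mk _ _ w :=
    { τ₁ := 𝟙 _, τ₂ := 𝟙 _, τ₃ := image.ι φ
      comm₂₃ := (Category.id_comp _).trans (image.fac φ).symm }
  have : IsIso ψ.τ₂ := inferInstanceAs (IsIso (𝟙 _))
  have : Epi ψ.τ₁ := inferInstanceAs (Epi (𝟙 _))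
  have : Mono ψ.τ₃ := inferInstanceAs (Mono (image.ι φ))
  have h₁ : (ShortComplex.mk _ _ w₁).ShortExact :=
    { exact := (ShortComplex.exact_iff_of_epi_of_isIso_of_mono ψ).2 hex
      mono_f := hδ
      epi_g := inferInstanceAs (Epi (factorThruImage φ)) }
  have h₂ : (ShortComplex.mk _ _ (cokernel.condition (image.ι φ))).ShortExact :=
    { exact := ShortComplex.exact_cokernel _
      mono_f := inferInstanceAs (Mono (image.ι φ))
      epi_g := inferInstanceAs (Epi (cokernel.π _)) }
  refine depth_eq_depth_add_of_opcycles Q hm hl hs hd (fun i hi => hH i (by lia)) hO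
    (image.fac φ) h₁ h₂ fun n _ hn => ?_
  have : n = 0 := by
    have := hn.trans hT
    norm_cast at this
    lia
  simp [this]

theorem depth_add_eq_of_isFiniteQuasiProjRes {M : ModuleCat.{u} R} {s t : ℤ}
    (hP : IsFiniteQuasiProjRes M P) (hs : IsSup P s) (ht : IsHSup P t)
    (hd : ∀ i j, i = s → j + 1 = i →
      ¬ Mono (P.d i j ▷ ModuleCat.of R (IsLocalRing.ResidueField R))) {q : ℕ}
    (hq : ¬ IsZero ((tensorHomology Q q).obj M))
    (hq' : ∀ i : ℕ, q < i → IsZero ((tensorHomology Q i).obj M))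
    (hdep : q = 0 ∨ depth ((tensorHomology Q q).obj M) ≤ 1) :
    depth N + (q : ℕ∞) = depth ((tensorHomology Q q).obj M) + ((s - t).toNat : ℕ∞) := by
  obtain ⟨mult, -, hmult⟩ := hP.homology_iso
  have hb := hP.bddBelow
  have hts : t ≤ s := ht.le_of_isSup hs
  have e (i : ℕ) (j : ℤ) : Nonempty ((tensorHomology Q i).obj (P.homology j) ≅
      (tensorHomology Q i).obj (copies M (mult j))) :=
    (hmult j).map (tensorHomology Q i).mapIso
  have hmt : mult t ≠ 0 := by
    intro h
    refine ht.1 ((hmult t).some.isZero_iff.2 ?_)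
    rw [h]
    exact (IsZero.iff_id_eq_zero _).2 (biproduct.hom_ext _ _ fun i => i.elim0)
  have hT (j : ℤ) (i : ℕ) (hi : q < i) : IsZero ((tensorHomology Q i).obj (P.homology j)) :=
    (e i j).some.isZero_iff.2 (isZero_map_copies _ (hq' i hi) _)
  have hdt (i : ℕ) : depth ((tensorHomology Q i).obj (P.homology t)) =
      depth ((tensorHomology Q i).obj M) :=
    (e i t).some.depth_eq.trans (depth_map_copies _ M hmt)
  have hO := isZero_tensorHomology_opcycles Q hb hT
  obtain _ | q := q
  · have := depth_eq_depth_tensorHomology_zero_add Q (L := (s - t).toNat) (t := t) (by lia) hb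
      hs.2 hd ht.2 hT fun j n hn => by
        rw [(e 0 j).some.depth_eq]
        rw [hdt] at hn
        exact le_depth_map_copies _ hn _
    rw [hdt] at this
    simpa using this
  · obtain ⟨e₁⟩ := nonempty_iso_of_isZero_tensorHomology_X₃ Q
      (shortExact_homology_opcycles P (sub_add_cancel t 1)) (i := q + 1)
      (isZero_tensorHomology_image Q (sub_add_cancel t 1) (hO _ _ (by lia)))
      (isZero_tensorHomology_image Q (sub_add_cancel t 1) (hO _ _ (by lia)))
    have hqt : ¬ IsZero ((tensorHomology Q (q + 1)).obj (P.opcycles t)) := fun h =>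
      hq (isZero_map_of_copies _ hmt ((e (q + 1) t).some.isZero_iff.1 (e₁.isZero_iff.2 h)))
    have hqs : t + q < s := by
      by_contra! hc
      obtain ⟨e₂⟩ := nonempty_tensorHomology_opcycles_iso Q ht.2 (s - t).toNat
        (q - (s - t).toNat) (q + 1) s (by lia) (by lia)
      have : IsIso (P.pOpcycles s) :=
        P.isIso_pOpcycles _ _ rfl ((hs.2 _ (by simp)).eq_of_src _ _)
      exact hqt (e₂.isZero_iff.2 (((tensorHomology Q _).mapIso
        (asIso (P.pOpcycles s))).isZero_iff.1 (isZero_tensorHomology_of_flat Q _ _)))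
    obtain ⟨e₂⟩ := nonempty_tensorHomology_opcycles_iso Q ht.2 q 0 (q + 1) (t + q) (by lia) rfl
    have hd₂ : depth ((tensorHomology Q 1).obj (P.opcycles (t + q))) =
        depth ((tensorHomology Q (q + 1)).obj M) := by
      rw [← hdt, e₁.depth_eq, e₂.depth_eq]
    have := depth_eq_depth_tensorHomology_opcycles_add Q (L := (s - (t + q + 1)).toNat)
      (m := t + q + 1) (by lia) rfl hs.2 hd (fun i hi => ht.2 i (by lia)) (fun i hi => by
        obtain ⟨e₃⟩ := nonempty_tensorHomology_opcycles_iso Q ht.2 (i - t).toNat 0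
          (1 + (i - t).toNat) i (by lia) (by lia)
        exact e₃.isZero_iff.1 (hO t _ (by lia))) (hd₂ ▸ hdep.resolve_left q.succ_ne_zero)
    rw [this, hd₂, add_assoc, ← Nat.cast_add]
    congr 2
    lia

end DepthFormula

end QPD

open QPD in
/-- The depth formula for modules of finite quasi-projective dimension
over a commutative Noetherian local ring (stated additively in `ℕ∞`):
`depth N + q = depth (Tor_q(M, N)) + qpd M`. -/
theorem depth_formula {R : Type u} [CommRing R] [IsNoetherianRing R] [IsLocalRing R]
    (M N : ModuleCat.{u} R) [Module.Finite R M] [Module.Finite R N]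
    (hM : ¬ IsZero M) (hN : ¬ IsZero N)
    (q : ℕ)
    (hq : ¬ IsZero (((Tor (ModuleCat.{u} R) q).obj M).obj N))
    (hq' : ∀ i : ℕ, q < i → IsZero (((Tor (ModuleCat.{u} R) i).obj M).obj N))
    (hqpd : qpd M < ⊤)
    (hdep : q = 0 ∨ depth (((Tor (ModuleCat.{u} R) q).obj M).obj N) ≤ 1) :
    depth N + (q : ℕ∞) = depth (((Tor (ModuleCat.{u} R) q).obj M).obj N) + qpd M := by
  obtain ⟨P, s, t, hP, hs, ht, h⟩ := exists_isFiniteQuasiProjRes_eq_qpd hM hqpd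
  have hflat (i : ℤ) : Module.Flat R (P.X i) :=
    have : Module.Projective R (P.X i) := (IsProjective.iff_projective _).2 (hP.projective i)
    inferInstance
  let Q := projectiveResolution N
  have e (i : ℕ) := tensorHomologyIsoTor Q i M
  rw [h, ← (e q).depth_eq]
  rw [← (e q).depth_eq] at hdep
  refine depth_add_eq_of_isFiniteQuasiProjRes Q hP hs ht ?_ (fun h' => hq ((e q).isZero_iff.1 h'))
    (fun i hi => (e i).isZero_iff.2 (hq' i hi)) hdep
  rintro _ r rfl rfl
  exact not_mono_d_whiskerRight_of_eq_qpd hP hs ht h
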